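/- arXiv:2512.04468 — 3 statements merged into one kernel-verified Lean document; each statement's English description precedes it below -/
import Mathlib

section
/- (Yang–Baxter equation for the spin-1 weights W_{x;(u,v)}.) Let F be a field, q, u, v ∈ F, and let x, y be nonzero elements of F with 1 + u x ≠ 0, 1 + u y ≠ 0 and 1 − q·(y/x) ≠ 0. Then for all a₁, a₂, b₁, b₂ ∈ {0,1} and a₃, b₃ ∈ ℕ one has Σ_{c₁,c₂∈{0,1}, c₃∈ℕ} R_{y/x}(a₁,a₂,c₁,c₂)·W_{x;(u,v)}(a₃,c₂,c₃,b₂)·W_{y;(u,v)}(c₃,c₁,b₃,b₁) = Σ_{c₁,c₂∈{0,1}, c₃∈ℕ} W_{y;(u,v)}(a₃,a₁,c₃,c₁)·W_{x;(u,v)}(c₃,a₂,b₃,c₂)·R_{y/x}(c₁,c₂,b₁,b₂), where all sums have only finitely many nonzero terms. -/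
open Classical

noncomputable section

/-- The q-Pochhammer symbol `(a;q)_k = ∏_{j=0}^{k-1} (1 - a q^j)`. -/
def qPoch {F : Type*} [Field F] (q a : F) (k : ℕ) : F :=
  ∏ j ∈ Finset.range k, (1 - a * q ^ j)

/-- The q-binomial coefficient `[n choose k]_q`, zero unless `k ≤ n`. -/
def qBinom {F : Type*} [Field F] (q : F) (n k : ℕ) : F :=
  if k ≤ n then qPoch q q n / (qPoch q q k * qPoch q q (n - k)) else 0

/-- The spin-1 vertex weight `W_{x;(u,v)}(a,b,c,d)`, with arguments ordered
(bottom, left, top, right); the horizontal labels `b,d` are effectively in `{0,1}`. -/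
def w1 {F : Type*} [Field F] (q u v x : F) (a b c d : ℕ) : F :=
  if b = 0 ∧ d = 0 ∧ c = a then (1 + u * x * q ^ a) / (1 + u * x)
  else if b = 0 ∧ d = 1 ∧ c + 1 = a then (1 - q ^ a) * x / (1 + u * x)
  else if b = 1 ∧ d = 0 ∧ c = a + 1 then (1 - u * v * q ^ a) / (1 + u * x)
  else if b = 1 ∧ d = 1 ∧ c = a then (x + v * q ^ a) / (1 + u * x)
  else 0

/-- The spin-1 R-matrix `R_z(a,b,c,d)`, arguments ordered (bottom, left, top, right). -/
def rmat1 {F : Type*} [Field F] (q z : F) (a b c d : ℕ) : F :=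
  if a = 0 ∧ b = 0 ∧ c = 0 ∧ d = 0 then 1
  else if a = 1 ∧ b = 0 ∧ c = 1 ∧ d = 0 then q * (1 - z) / (1 - q * z)
  else if a = 1 ∧ b = 0 ∧ c = 0 ∧ d = 1 then (1 - q) / (1 - q * z)
  else if a = 1 ∧ b = 1 ∧ c = 1 ∧ d = 1 then 1
  else if a = 0 ∧ b = 1 ∧ c = 0 ∧ d = 1 then (1 - z) / (1 - q * z)
  else if a = 0 ∧ b = 1 ∧ c = 1 ∧ d = 0 then (1 - q) * z / (1 - q * z)
  else 0

/-- The dual spin-1 vertex weight `W*_{x;(u,v)}(a,b,c,d)`. -/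
def w1dual {F : Type*} [Field F] (q u v x : F) (a b c d : ℕ) : F :=
  if b = 1 ∧ d = 1 ∧ c = a then (x + u * q ^ a) / (1 + v * x)
  else if b = 1 ∧ d = 0 ∧ c + 1 = a then (1 - q ^ a) / (1 + v * x)
  else if b = 0 ∧ d = 1 ∧ c = a + 1 then (1 - u * v * q ^ a) * x / (1 + v * x)
  else if b = 0 ∧ d = 0 ∧ c = a then (1 + v * x * q ^ a) / (1 + v * x)
  else 0

/-- The dual crossing weights `R*_{x,y}(a,b,c,d)`, arguments (bottom, left, top, right). -/
def rdual {F : Type*} [Field F] (q x y : F) (a b c d : ℕ) : F :=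
  if a = 0 ∧ b = 1 ∧ c = 0 ∧ d = 1 then 1
  else if a = 1 ∧ b = 1 ∧ c = 1 ∧ d = 1 then q * (1 - x * y) / (1 - q * x * y)
  else if a = 1 ∧ b = 1 ∧ c = 0 ∧ d = 0 then (1 - q) / (1 - q * x * y)
  else if a = 1 ∧ b = 0 ∧ c = 1 ∧ d = 0 then 1
  else if a = 0 ∧ b = 0 ∧ c = 0 ∧ d = 0 then (1 - x * y) / (1 - q * x * y)
  else if a = 0 ∧ b = 0 ∧ c = 1 ∧ d = 1 then (1 - q) * x * y / (1 - q * x * y)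
  else 0


theorem w1_sum {F : Type*} [Field F] (q u v x : F) (a b d : ℕ) (hb : b ≤ 1) (hd : d ≤ 1)
    (f : ℕ → F) :
    ∑ c ∈ Finset.range (a + 2), w1 q u v x a b c d * f c =
      if b = 0 then
        (if d = 0 then (1 + u * x * q ^ a) / (1 + u * x) * f a
          else (1 - q ^ a) * x / (1 + u * x) * f (a - 1))
      else
        (if d = 0 then (1 - u * v * q ^ a) / (1 + u * x) * f (a + 1)
          else (x + v * q ^ a) / (1 + u * x) * f a) := by
  interval_cases b <;> interval_cases d
  · rw [Finset.sum_eq_single a] <;> simp +contextual [w1]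
  · rcases a with _ | n
    · simp [w1]
    · rw [Finset.sum_eq_single n] <;> simp +contextual [w1]
      omega
  · rw [Finset.sum_eq_single (a + 1)] <;> simp +contextual [w1]
  · rw [Finset.sum_eq_single a] <;> simp +contextual [w1]

theorem w1_ne {F : Type*} [Field F] {q u v x : F} {a b c d : ℕ}
    (h : w1 q u v x a b c d ≠ 0) : b ≤ 1 ∧ d ≤ 1 ∧ c + d = a + b := by
  unfold w1 at h
  split_ifs at h <;> first | omega | simp at h

theorem rmat1_ne {F : Type*} [Field F] {q z : F} {a b c d : ℕ}
    (h : rmat1 q z a b c d ≠ 0) : c + d = a + b := by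
  unfold rmat1 at h
  split_ifs at h <;> first | omega | simp at h

theorem w1_sum_left {F : Type*} [Field F] (q u v x R : F) (a b d : ℕ) (hb : b ≤ 1) (hd : d ≤ 1)
    (f : ℕ → F) :
    ∑ c ∈ Finset.range (a + 2), R * w1 q u v x a b c d * f c = R * (if b = 0 then
        (if d = 0 then (1 + u * x * q ^ a) / (1 + u * x) * f a
          else (1 - q ^ a) * x / (1 + u * x) * f (a - 1))
      else
        (if d = 0 then (1 - u * v * q ^ a) / (1 + u * x) * f (a + 1)
          else (x + v * q ^ a) / (1 + u * x) * f a)) := by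
  rw [← w1_sum q u v x a b d hb hd f, Finset.mul_sum]
  exact Finset.sum_congr rfl fun k _ => by ring

theorem w1_sum_right {F : Type*} [Field F] (q u v x R : F) (a b d : ℕ) (hb : b ≤ 1) (hd : d ≤ 1)
    (f : ℕ → F) :
    ∑ c ∈ Finset.range (a + 2), w1 q u v x a b c d * f c * R = (if b = 0 then
        (if d = 0 then (1 + u * x * q ^ a) / (1 + u * x) * f a
          else (1 - q ^ a) * x / (1 + u * x) * f (a - 1))
      else
        (if d = 0 then (1 - u * v * q ^ a) / (1 + u * x) * f (a + 1)
          else (x + v * q ^ a) / (1 + u * x) * f a)) * R := by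
  rw [← w1_sum q u v x a b d hb hd f, Finset.sum_mul]

theorem rsum_box {F : Type*} [Field F] (n : ℕ) (f : ℕ × ℕ × ℕ → F)
    (h : ∀ c, f c ≠ 0 → c.1 ≤ 1 ∧ c.2.1 ≤ 1 ∧ c.2.2 < n) :
    (Function.support f).Finite ∧
    ∑ᶠ c, f c = ∑ i ∈ Finset.range 2, ∑ j ∈ Finset.range 2, ∑ k ∈ Finset.range n, f (i, j, k) := by
  have hs : Function.support f ⊆
      ((Finset.range 2 ×ˢ Finset.range 2 ×ˢ Finset.range n : Finset (ℕ × ℕ × ℕ)) : Set _) := by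
    intro c hc
    have := h c hc
    simp only [Finset.coe_product, Finset.coe_range, Set.mem_prod, Set.mem_Iio]
    omega
  refine ⟨(Finset.finite_toSet _).subset hs, ?_⟩
  rw [finsum_eq_sum_of_support_subset _ hs, Finset.sum_product]
  simp only [Finset.sum_product]

set_option maxHeartbeats 2000000 in
/-- **Yang–Baxter equation for the spin-1 weights `W_{x;(u,v)}`.** -/
theorem yang_baxter_spin1 {F : Type*} [Field F] (q u v x y : F)
    (hx : x ≠ 0) (hy : y ≠ 0)
    (hux : 1 + u * x ≠ 0) (huy : 1 + u * y ≠ 0) (hr : 1 - q * (y / x) ≠ 0)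
    (a₁ a₂ b₁ b₂ : ℕ) (ha₁ : a₁ ≤ 1) (ha₂ : a₂ ≤ 1) (hb₁ : b₁ ≤ 1) (hb₂ : b₂ ≤ 1)
    (a₃ b₃ : ℕ) :
    (Function.support fun c : ℕ × ℕ × ℕ =>
        rmat1 q (y / x) a₁ a₂ c.1 c.2.1 * w1 q u v x a₃ c.2.1 c.2.2 b₂ *
          w1 q u v y c.2.2 c.1 b₃ b₁).Finite ∧
    (Function.support fun c : ℕ × ℕ × ℕ =>
        w1 q u v y a₃ a₁ c.2.2 c.1 * w1 q u v x c.2.2 a₂ b₃ c.2.1 *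
          rmat1 q (y / x) c.1 c.2.1 b₁ b₂).Finite ∧
    (∑ᶠ c : ℕ × ℕ × ℕ,
        rmat1 q (y / x) a₁ a₂ c.1 c.2.1 * w1 q u v x a₃ c.2.1 c.2.2 b₂ *
          w1 q u v y c.2.2 c.1 b₃ b₁) =
      ∑ᶠ c : ℕ × ℕ × ℕ,
        w1 q u v y a₃ a₁ c.2.2 c.1 * w1 q u v x c.2.2 a₂ b₃ c.2.1 *
          rmat1 q (y / x) c.1 c.2.1 b₁ b₂ := by
  
  obtain ⟨h1, e1⟩ := rsum_box (a₃ + 2) (fun c : ℕ × ℕ × ℕ =>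
        rmat1 q (y / x) a₁ a₂ c.1 c.2.1 * w1 q u v x a₃ c.2.1 c.2.2 b₂ *
          w1 q u v y c.2.2 c.1 b₃ b₁) (by
    intro c hc
    have h1 := w1_ne (right_ne_zero_of_mul hc)
    have h2 := w1_ne (right_ne_zero_of_mul (left_ne_zero_of_mul hc))
    omega)
  obtain ⟨h2, e2⟩ := rsum_box (a₃ + 2) (fun c : ℕ × ℕ × ℕ =>
        w1 q u v y a₃ a₁ c.2.2 c.1 * w1 q u v x c.2.2 a₂ b₃ c.2.1 *
          rmat1 q (y / x) c.1 c.2.1 b₁ b₂) (by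
    intro c hc
    have h1 := w1_ne (right_ne_zero_of_mul (left_ne_zero_of_mul hc))
    have h2 := w1_ne (left_ne_zero_of_mul (left_ne_zero_of_mul hc))
    omega)
  refine ⟨h1, h2, ?_⟩
  by_cases hc : b₃ + b₁ + b₂ = a₃ + a₁ + a₂
  swap
  · clear h1 h2 e1 e2
    rw [finsum_eq_zero_of_forall_eq_zero, finsum_eq_zero_of_forall_eq_zero]
    · intro c
      by_contra hn
      have h1 := w1_ne (right_ne_zero_of_mul (left_ne_zero_of_mul hn))
      have h2 := w1_ne (left_ne_zero_of_mul (left_ne_zero_of_mul hn))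
      have h3 := rmat1_ne (right_ne_zero_of_mul hn)
      omega
    · intro c
      by_contra hn
      have h1 := w1_ne (right_ne_zero_of_mul hn)
      have h2 := w1_ne (right_ne_zero_of_mul (left_ne_zero_of_mul hn))
      have h3 := rmat1_ne (left_ne_zero_of_mul (left_ne_zero_of_mul hn))
      omega
  rw [e1, e2]
  clear h1 h2 e1 e2
  have hr' : x - q * y ≠ 0 := by
    intro h
    apply hr
    rw [sub_eq_zero] at h ⊢
    field_simp
    exact h
  have hr2 : 1 - q * (y / x) = (x - q * y) / x := by field_simp
  have hr3 : x - y * q ≠ 0 := by rwa [mul_comm y q]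
  have hux' : 1 + x * u ≠ 0 := by rwa [mul_comm x u]
  have huy' : 1 + y * u ≠ 0 := by rwa [mul_comm y u]
  simp only [Finset.sum_range_succ (n := 1), Finset.sum_range_one]
  have h01 : (0 : ℕ) ≤ 1 := by omega
  have h11 : (1 : ℕ) ≤ 1 := le_refl 1
  rw [w1_sum_left (hb := h01) (hd := hb₂) (f := fun k => w1 q u v y k 0 b₃ b₁),
    w1_sum_left (hb := h11) (hd := hb₂) (f := fun k => w1 q u v y k 0 b₃ b₁),
    w1_sum_left (hb := h01) (hd := hb₂) (f := fun k => w1 q u v y k 1 b₃ b₁),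
    w1_sum_left (hb := h11) (hd := hb₂) (f := fun k => w1 q u v y k 1 b₃ b₁),
    w1_sum_right (hb := ha₁) (hd := h01) (f := fun k => w1 q u v x k a₂ b₃ 0),
    w1_sum_right (hb := ha₁) (hd := h01) (f := fun k => w1 q u v x k a₂ b₃ 1),
    w1_sum_right (hb := ha₁) (hd := h11) (f := fun k => w1 q u v x k a₂ b₃ 0),
    w1_sum_right (hb := ha₁) (hd := h11) (f := fun k => w1 q u v x k a₂ b₃ 1)]
  obtain rfl : b₃ = a₃ + a₁ + a₂ - b₁ - b₂ := by omega
  rcases a₃ with _ | _ | n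
  all_goals
    interval_cases a₁ <;> interval_cases a₂ <;> interval_cases b₁ <;> interval_cases b₂ <;>
      first
      | omega
      | (simp [rmat1, w1, hr2, -mul_eq_mul_left_iff, -mul_eq_mul_right_iff, -mul_eq_zero, -div_eq_zero_iff]; done)
      | (simp [rmat1, w1, hr2, -mul_eq_mul_left_iff, -mul_eq_mul_right_iff, -mul_eq_zero, -div_eq_zero_iff]; field_simp; done)
      | (simp [rmat1, w1, hr2, -mul_eq_mul_left_iff, -mul_eq_mul_right_iff, -mul_eq_zero, -div_eq_zero_iff]; field_simp; ring1)
      | (simp [rmat1, w1, hr2, -mul_eq_mul_left_iff, -mul_eq_mul_right_iff, -mul_eq_zero, -div_eq_zero_iff]; field_simp)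
end
end

section
/- (Yang–Baxter equation mixing the spin-1 weights with the dual spin-1 weights.) Let F be a field and q, u, v, x, y ∈ F with 1 + u y ≠ 0, 1 + v x ≠ 0 and 1 − q x y ≠ 0. Then for all a₁, a₂, b₁, b₂ ∈ {0,1} and a₃, b₃ ∈ ℕ one has Σ_{c₁,c₂∈{0,1}, c₃∈ℕ} R*_{x,y}(a₁,a₂,c₁,c₂)·W*_{x;(u,v)}(a₃,c₂,c₃,b₂)·W_{y;(u,v)}(c₃,c₁,b₃,b₁) = Σ_{c₁,c₂∈{0,1}, c₃∈ℕ} W_{y;(u,v)}(a₃,a₁,c₃,c₁)·W*_{x;(u,v)}(c₃,a₂,b₃,c₂)·R*_{x,y}(c₁,c₂,b₁,b₂), where all sums have only finitely many nonzero terms. -/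
open Classical

noncomputable section

lemma ybms_sum {F : Type*} [Field F] (f : ℕ × ℕ × ℕ → F) (g : ℕ × ℕ → ℕ)
    (h : ∀ c₁ c₂ c₃, f (c₁, c₂, c₃) ≠ 0 → c₁ ≤ 1 ∧ c₂ ≤ 1 ∧ c₃ = g (c₁, c₂)) :
    (Function.support f).Finite ∧
    (∑ᶠ c, f c) = f (0, 0, g (0, 0)) + f (0, 1, g (0, 1)) + f (1, 0, g (1, 0))
      + f (1, 1, g (1, 1)) := by
  have hs : Function.support f ⊆
      (({(0, 0, g (0, 0)), (0, 1, g (0, 1)), (1, 0, g (1, 0)), (1, 1, g (1, 1))} :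
        Finset (ℕ × ℕ × ℕ)) : Set (ℕ × ℕ × ℕ)) := by
    rintro ⟨c₁, c₂, c₃⟩ hc
    obtain ⟨h1, h2, h3⟩ := h c₁ c₂ c₃ hc
    subst h3
    interval_cases c₁ <;> interval_cases c₂ <;> simp
  refine ⟨(Finset.finite_toSet _).subset hs, ?_⟩
  rw [finsum_eq_sum_of_support_subset f hs]
  rw [Finset.sum_insert (by simp), Finset.sum_insert (by simp), Finset.sum_insert (by simp),
    Finset.sum_singleton]
  ring

lemma ybms_rdual {F : Type*} [Field F] {q x y : F} {a b c d : ℕ}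
    (h : rdual q x y a b c d ≠ 0) :
    a ≤ 1 ∧ b ≤ 1 ∧ c ≤ 1 ∧ d ≤ 1 ∧ a + d = c + b := by
  unfold rdual at h
  split_ifs at h <;> first | omega | exact absurd rfl h

lemma ybms_w1 {F : Type*} [Field F] {q u v x : F} {a b c d : ℕ}
    (h : w1 q u v x a b c d ≠ 0) : b ≤ 1 ∧ d ≤ 1 ∧ a + b = c + d := by
  unfold w1 at h
  split_ifs at h <;> first | omega | exact absurd rfl h

lemma ybms_w1dual {F : Type*} [Field F] {q u v x : F} {a b c d : ℕ}
    (h : w1dual q u v x a b c d ≠ 0) : b ≤ 1 ∧ d ≤ 1 ∧ a + d = c + b := by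
  unfold w1dual at h
  split_ifs at h <;> first | omega | exact absurd rfl h

set_option maxHeartbeats 4000000 in
/-- **Yang–Baxter equation mixing the spin-1 weights with the dual spin-1 weights.** -/
theorem yang_baxter_mixed_spin1 {F : Type*} [Field F] (q u v x y : F)
    (huy : 1 + u * y ≠ 0) (hvx : 1 + v * x ≠ 0) (hr : 1 - q * x * y ≠ 0)
    (a₁ a₂ b₁ b₂ : ℕ) (ha₁ : a₁ ≤ 1) (ha₂ : a₂ ≤ 1) (hb₁ : b₁ ≤ 1) (hb₂ : b₂ ≤ 1)
    (a₃ b₃ : ℕ) :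
    (Function.support fun c : ℕ × ℕ × ℕ =>
        rdual q x y a₁ a₂ c.1 c.2.1 * w1dual q u v x a₃ c.2.1 c.2.2 b₂ *
          w1 q u v y c.2.2 c.1 b₃ b₁).Finite ∧
    (Function.support fun c : ℕ × ℕ × ℕ =>
        w1 q u v y a₃ a₁ c.2.2 c.1 * w1dual q u v x c.2.2 a₂ b₃ c.2.1 *
          rdual q x y c.1 c.2.1 b₁ b₂).Finite ∧
    (∑ᶠ c : ℕ × ℕ × ℕ,
        rdual q x y a₁ a₂ c.1 c.2.1 * w1dual q u v x a₃ c.2.1 c.2.2 b₂ *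
          w1 q u v y c.2.2 c.1 b₃ b₁) =
      ∑ᶠ c : ℕ × ℕ × ℕ,
        w1 q u v y a₃ a₁ c.2.2 c.1 * w1dual q u v x c.2.2 a₂ b₃ c.2.1 *
          rdual q x y c.1 c.2.1 b₁ b₂ := by
  have hL := ybms_sum (fun c : ℕ × ℕ × ℕ =>
        rdual q x y a₁ a₂ c.1 c.2.1 * w1dual q u v x a₃ c.2.1 c.2.2 b₂ *
          w1 q u v y c.2.2 c.1 b₃ b₁) (fun c => a₃ + b₂ - c.2) (by
    intro c₁ c₂ c₃ h
    have h1 := ybms_rdual (left_ne_zero_of_mul (left_ne_zero_of_mul h))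
    have h2 := ybms_w1dual (right_ne_zero_of_mul (left_ne_zero_of_mul h))
    dsimp only at *
    omega)
  have hR := ybms_sum (fun c : ℕ × ℕ × ℕ =>
        w1 q u v y a₃ a₁ c.2.2 c.1 * w1dual q u v x c.2.2 a₂ b₃ c.2.1 *
          rdual q x y c.1 c.2.1 b₁ b₂) (fun c => a₃ + a₁ - c.1) (by
    intro c₁ c₂ c₃ h
    have h1 := ybms_rdual (right_ne_zero_of_mul h)
    have h2 := ybms_w1 (left_ne_zero_of_mul (left_ne_zero_of_mul h))
    dsimp only at *
    omega)
  refine ⟨hL.1, hR.1, ?_⟩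
  by_cases hc : b₃ + a₂ + b₁ = a₃ + a₁ + b₂
  swap
  · trans (0 : F)
    · apply finsum_eq_zero_of_forall_eq_zero
      rintro ⟨c₁, c₂, c₃⟩
      by_contra h
      have h1 := ybms_rdual (left_ne_zero_of_mul (left_ne_zero_of_mul h))
      have h2 := ybms_w1dual (right_ne_zero_of_mul (left_ne_zero_of_mul h))
      have h3 := ybms_w1 (right_ne_zero_of_mul h)
      dsimp only at *
      omega
    · symm
      apply finsum_eq_zero_of_forall_eq_zero
      rintro ⟨c₁, c₂, c₃⟩
      by_contra h
      have h1 := ybms_rdual (right_ne_zero_of_mul h)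
      have h2 := ybms_w1 (left_ne_zero_of_mul (left_ne_zero_of_mul h))
      have h3 := ybms_w1dual (right_ne_zero_of_mul (left_ne_zero_of_mul h))
      dsimp only at *
      omega
  rw [hL.2, hR.2]
  clear hL hR
  obtain rfl : b₃ = a₃ + a₁ + b₂ - a₂ - b₁ := by omega
  have hr' : 1 - x * y * q ≠ 0 := by convert hr using 1; ring
  have hr0 : 1 - x * q * y ≠ 0 := by convert hr using 1; ring
  have hr1 : 1 - q * y * x ≠ 0 := by convert hr using 1; ring
  have hr2 : 1 - y * q * x ≠ 0 := by convert hr using 1; ring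
  have hr3 : 1 - y * x * q ≠ 0 := by convert hr using 1; ring
  rcases a₃ with _ | _ | m <;> interval_cases a₁ <;> interval_cases a₂ <;> interval_cases b₁ <;>
    interval_cases b₂ <;> first | (exfalso; omega) | skip
  all_goals simp [rdual, w1, w1dual]
  all_goals try field_simp
  all_goals try ring
end
end

section
/- (Yang–Baxter equation for the fused weights 𝕎 with the fused R-matrix.) Let F be a field, q, u, v ∈ F, and let x, y be nonzero elements of F with (q;q)_j ≠ 0 for all j ≥ 1. Then for all a₁, a₂, a₃, b₁, b₂, b₃ ∈ ℕ one has Σ_{c₁,c₂,c₃∈ℕ} ℝ_{x/y}(a₁,a₂,c₁,c₂)·𝕎_{x;(u,v)}(a₃,c₂,c₃,b₂)·𝕎_{y;(u,v)}(c₃,c₁,b₃,b₁) = Σ_{c₁,c₂,c₃∈ℕ} 𝕎_{y;(u,v)}(a₃,a₁,c₃,c₁)·𝕎_{x;(u,v)}(c₃,a₂,b₃,c₂)·ℝ_{x/y}(c₁,c₂,b₁,b₂), where both sums have only finitely many nonzero terms. -/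
open Classical

noncomputable section

/-- The fused R-matrix `ℝ_z(a,b,c,d)`, arguments (bottom, left, top, right). -/
def Rfused {F : Type*} [Field F] (q z : F) (a b c d : ℕ) : F :=
  if a + b = c + d ∧ b ≤ c then z ^ d * qPoch q z (c - b) * qBinom q a (c - b) else 0

/-- The fused vertex weight `𝕎_{x;(u,v)}(a,b,c,d)`, arguments (bottom, left, top, right). -/
def Wfused {F : Type*} [Field F] (q u v x : F) (a b c d : ℕ) : F :=
  if a + b = c + d then
    x ^ ((d : ℤ) - (b : ℤ)) *
      ∑ p ∈ Finset.range (min b c + 1),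
        qPoch q (u * x) (c - p) * v ^ (b - p) * (∏ j ∈ Finset.range p, (x - q ^ j * v)) *
          qBinom q (c + d - p) (c - p) * qBinom q b p
  else 0

section helpers
variable {F : Type*} [Field F]

theorem qPoch_succ (q a : F) (k : ℕ) : qPoch q a (k + 1) = qPoch q a k * (1 - a * q ^ k) := by
  simp [qPoch, Finset.prod_range_succ]

theorem qPoch_zero (q a : F) : qPoch q a 0 = 1 := by simp [qPoch]

theorem qPoch_ne {q : F} (hq : ∀ j : ℕ, 1 ≤ j → qPoch q q j ≠ 0) (n : ℕ) : qPoch q q n ≠ 0 := by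
  rcases Nat.eq_zero_or_pos n with h | h
  · subst h; simp [qPoch]
  · exact hq n h

theorem one_sub_ne {q : F} (hq : ∀ j : ℕ, 1 ≤ j → qPoch q q j ≠ 0) (n : ℕ) :
    1 - q ^ (n + 1) ≠ 0 := by
  have h := hq (n + 1) (by omega)
  rw [qPoch_succ] at h
  have := right_ne_zero_of_mul h
  rwa [pow_succ'] 

/-- two-index q-binomial -/
def qB (q : F) (k l : ℕ) : F := qPoch q q (k + l) / (qPoch q q k * qPoch q q l)

theorem qBinom_add (q : F) (k l : ℕ) : qBinom q (k + l) k = qB q k l := by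
  simp [qBinom, qB]

theorem qB_comm (q : F) (k l : ℕ) : qB q k l = qB q l k := by
  simp [qB, add_comm, mul_comm]

theorem qB_succ_left {q : F} (hq : ∀ j : ℕ, 1 ≤ j → qPoch q q j ≠ 0) (k l : ℕ) :
    (1 - q ^ (k + 1)) * qB q (k + 1) l = (1 - q ^ (k + l + 1)) * qB q k l := by
  have h1 := qPoch_ne hq k
  have h2 := qPoch_ne hq l
  have h3 := one_sub_ne hq k
  have e : k + 1 + l = k + l + 1 := by omega
  rw [qB, qB, e, qPoch_succ, qPoch_succ, ← pow_succ', ← pow_succ']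
  field_simp

theorem qB_succ_right {q : F} (hq : ∀ j : ℕ, 1 ≤ j → qPoch q q j ≠ 0) (k l : ℕ) :
    (1 - q ^ (l + 1)) * qB q k (l + 1) = (1 - q ^ (k + l + 1)) * qB q k l := by
  rw [qB_comm, qB_succ_left hq, qB_comm, add_comm l k]

theorem qB_zero_left {q : F} (hq : ∀ j : ℕ, 1 ≤ j → qPoch q q j ≠ 0) (k : ℕ) : qB q 0 k = 1 := by
  have := qPoch_ne hq k
  simp [qB, qPoch_zero, this]

theorem qB_zero_right {q : F} (hq : ∀ j : ℕ, 1 ≤ j → qPoch q q j ≠ 0) (k : ℕ) : qB q k 0 = 1 := by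
  rw [qB_comm, qB_zero_left hq]

theorem qB_pascal {q : F} (hq : ∀ j : ℕ, 1 ≤ j → qPoch q q j ≠ 0) (k l : ℕ) :
    qB q (k + 1) (l + 1) = qB q k (l + 1) + q ^ (k + 1) * qB q (k + 1) l := by
  have h1 := qB_succ_left hq k (l + 1)
  have h2 := qB_succ_right hq (k + 1) l
  have h0 := one_sub_ne hq (k + l + 1)
  have e1 : k + (l + 1) + 1 = k + l + 1 + 1 := by omega
  have e2 : k + 1 + l + 1 = k + l + 1 + 1 := by omega
  rw [e1] at h1
  rw [e2] at h2
  apply mul_left_cancel₀ h0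
  rw [mul_add, ← h1, mul_left_comm, ← h2]
  have : q ^ (k + l + 1 + 1) = q ^ (k + 1) * q ^ (l + 1) := by ring
  rw [this]
  ring

/-- `∏_{j<n} (a - q^j b)` -/
def phi (q a b : F) (n : ℕ) : F := ∏ j ∈ Finset.range n, (a - q ^ j * b)

theorem phi_succ (q a b : F) (n : ℕ) : phi q a b (n + 1) = phi q a b n * (a - q ^ n * b) := by
  simp [phi, Finset.prod_range_succ]

theorem phi_zero (q a b : F) : phi q a b 0 = 1 := by simp [phi]

theorem phi_smul (q t a b : F) (n : ℕ) : phi q (t * a) (t * b) n = t ^ n * phi q a b n := by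
  induction n with
  | zero => simp [phi_zero]
  | succ n ih => rw [phi_succ, phi_succ, ih]; ring

theorem phi_one (q b : F) (n : ℕ) : phi q 1 b n = qPoch q b n := by
  simp [phi, qPoch, mul_comm]

open Finset in
theorem phi_vandermonde {q : F} (hq : ∀ j : ℕ, 1 ≤ j → qPoch q q j ≠ 0) (a b c : F) (n : ℕ) :
    ∑ p ∈ HasAntidiagonal.antidiagonal n, qB q p.1 p.2 * phi q a b p.1 * phi q b c p.2 = phi q a c n := by
  induction n with
  | zero => simp [phi_zero, qB_zero_left hq]
  | succ n ih =>
    have h1 : phi q a c (n + 1) = ∑ p ∈ HasAntidiagonal.antidiagonal n,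
        qB q p.1 p.2 * phi q a b (p.1 + 1) * phi q b c p.2 +
        ∑ p ∈ HasAntidiagonal.antidiagonal n,
        q ^ p.1 * qB q p.1 p.2 * phi q a b p.1 * phi q b c (p.2 + 1) := by
      rw [phi_succ, ← ih, sum_mul, ← sum_add_distrib]
      apply sum_congr rfl
      rintro ⟨k, l⟩ h
      rw [HasAntidiagonal.mem_antidiagonal] at h
      simp only at h ⊢
      rw [phi_succ, phi_succ, ← h, pow_add]
      ring
    rw [h1]
    cases n with
    | zero => simp [Nat.antidiagonal_succ, qB_zero_left hq, qB_zero_right hq, phi_zero, add_comm]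
    | succ n =>
      rw [Nat.sum_antidiagonal_succ, Nat.sum_antidiagonal_succ']
      rw [Nat.sum_antidiagonal_succ' (n := n)]
      rw [Nat.sum_antidiagonal_succ (n := n)
        (f := fun p => q ^ p.1 * qB q p.1 p.2 * phi q a b p.1 * phi q b c (p.2 + 1))]
      have h2 : ∀ p : ℕ × ℕ, qB q (p.1 + 1) (p.2 + 1) * phi q a b (p.1 + 1) * phi q b c (p.2 + 1)
          = qB q p.1 (p.2 + 1) * phi q a b (p.1 + 1) * phi q b c (p.2 + 1) +
            q ^ (p.1 + 1) * qB q (p.1 + 1) p.2 * phi q a b (p.1 + 1) * phi q b c (p.2 + 1) := by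
        intro p
        rw [qB_pascal hq]; ring
      simp only [h2, sum_add_distrib, qB_zero_left hq, qB_zero_right hq, phi_zero, pow_zero]
      ring

/-- auxiliary -/
def GG (q w : F) (c d p : ℕ) : F :=
  if p ≤ c then qPoch q w (c - p) * qB q (c - p) d else 0

/-- auxiliary: reduced weight -/
def UU (q u v x : F) (b c d : ℕ) : F :=
  ∑ p ∈ Finset.HasAntidiagonal.antidiagonal b, qB q p.1 p.2 * v ^ p.2 * phi q x v p.1 * GG q (u * x) c d p.1

theorem GG_add (q w : F) (p e d : ℕ) : GG q w (p + e) d p = qPoch q w e * qB q e d := by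
  simp [GG]

theorem GG_lt (q w : F) {c p : ℕ} (d : ℕ) (h : c < p) : GG q w c d p = 0 := by
  simp [GG, h]

theorem GG_succ (q w : F) (c d p : ℕ) : GG q w (c + 1) d (p + 1) = GG q w c d p := by
  simp [GG]

open Finset in
theorem Wfused_eq (q u v x : F) (a b c d : ℕ) (h : a + b = c + d) :
    Wfused q u v x a b c d = x ^ ((d : ℤ) - (b : ℤ)) * UU q u v x b c d := by
  rw [Wfused, if_pos h, UU, Nat.sum_antidiagonal_eq_sum_range_succ_mk]
  congr 1
  have hsub : range (min b c + 1) ⊆ range (b + 1) := by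
    intro i; simp only [mem_range]; omega
  rw [← sum_subset hsub]
  · apply sum_congr rfl
    intro p hp
    rw [mem_range] at hp
    obtain ⟨r, rfl⟩ : ∃ r, b = p + r := ⟨b - p, by omega⟩
    obtain ⟨e, rfl⟩ : ∃ e, c = p + e := ⟨c - p, by omega⟩
    have e1 : p + e + d - p = e + d := by omega
    simp only [GG_add, e1, Nat.add_sub_cancel_left, qBinom_add, phi]
    ring
  · intro p hp hp'
    simp only [mem_range] at hp hp'
    rw [GG_lt _ _ _ (by omega), mul_zero]

open Finset in
theorem UU_E1 {q : F} (hq : ∀ j : ℕ, 1 ≤ j → qPoch q q j ≠ 0) (u v x : F) (a b c d : ℕ)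
    (h : a + b = c + d + 1) :
    (1 - q ^ (d + 1)) * UU q u v x b c (d + 1) =
      (1 - q ^ a) * UU q u v x b c d + v * q ^ a * (1 - q ^ b) * UU q u v x (b - 1) c d := by
  have key : ∀ p ∈ HasAntidiagonal.antidiagonal b,
      (1 - q ^ (d + 1)) * (qB q p.1 p.2 * v ^ p.2 * phi q x v p.1 * GG q (u * x) c (d + 1) p.1) =
      (1 - q ^ a) * (qB q p.1 p.2 * v ^ p.2 * phi q x v p.1 * GG q (u * x) c d p.1) +
      q ^ a * ((1 - q ^ p.2) * qB q p.1 p.2 * v ^ p.2 * phi q x v p.1 * GG q (u * x) c d p.1) := by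
    rintro ⟨p, r⟩ hp
    rw [HasAntidiagonal.mem_antidiagonal] at hp
    simp only at hp ⊢
    by_cases hpc : p ≤ c
    · obtain ⟨e, rfl⟩ : ∃ e, c = p + e := ⟨c - p, by omega⟩
      rw [GG_add, GG_add]
      have := qB_succ_right hq e d
      have e1 : e + d + 1 = a + r := by omega
      rw [e1, pow_add] at this
      linear_combination (qB q p r * v ^ r * phi q x v p * qPoch q (u * x) e) * this
    · rw [GG_lt _ _ _ (by omega), GG_lt _ _ _ (by omega)]; ring
  rw [UU, mul_sum, sum_congr rfl key, sum_add_distrib, ← mul_sum, ← mul_sum, ← UU]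
  congr 1
  cases b with
  | zero => simp
  | succ b =>
    rw [Nat.sum_antidiagonal_succ']
    simp only [pow_zero, sub_self, zero_mul, add_zero, zero_add, Nat.add_sub_cancel, UU]
    rw [mul_sum, mul_sum]
    apply sum_congr rfl
    rintro ⟨p, r⟩ hp
    rw [HasAntidiagonal.mem_antidiagonal] at hp
    simp only at hp ⊢
    have := qB_succ_right hq p r
    rw [hp] at this
    rw [this]; ring

open Finset in
theorem UU_E2 {q : F} (hq : ∀ j : ℕ, 1 ≤ j → qPoch q q j ≠ 0) (u v x : F) (a b c d : ℕ)
    (h : a + b = c + d + 1) :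
    (1 - q ^ (c + 1)) * UU q u v x b (c + 1) d
      + u * x * q ^ c * ((1 - q ^ (d + 1)) * UU q u v x b c (d + 1)) =
      q ^ b * (1 - q ^ a) * UU q u v x b c d + x * (1 - q ^ b) * UU q u v x (b - 1) c d := by
  have h2 : x * (1 - q ^ b) * UU q u v x (b - 1) c d =
      ∑ p ∈ HasAntidiagonal.antidiagonal b, (1 - q ^ p.1) * qB q p.1 p.2 * v ^ p.2 * phi q x v p.1 *
        GG q (u * x) (c + 1) d p.1 +
      ∑ p ∈ HasAntidiagonal.antidiagonal b, q ^ p.1 * (1 - q ^ p.2) * qB q p.1 p.2 * v ^ p.2 * phi q x v p.1 *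
        GG q (u * x) c d p.1 := by
    cases b with
    | zero => simp
    | succ b =>
      rw [Nat.sum_antidiagonal_succ, Nat.sum_antidiagonal_succ']
      simp only [pow_zero, sub_self, zero_mul, mul_zero, add_zero, zero_add, Nat.add_sub_cancel, UU]
      rw [mul_sum, ← sum_add_distrib]
      apply sum_congr rfl
      rintro ⟨p, r⟩ hp
      rw [HasAntidiagonal.mem_antidiagonal] at hp
      simp only at hp ⊢
      have t1 := qB_succ_right hq p r
      have t2 := qB_succ_left hq p r
      rw [hp] at t1 t2
      rw [GG_succ, t2, phi_succ, mul_assoc (q ^ p), t1]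
      ring
  rw [h2, UU, UU, UU, mul_sum, mul_sum, mul_sum, mul_sum, ← sum_add_distrib, ← sum_add_distrib,
    ← sum_add_distrib]
  apply sum_congr rfl
  rintro ⟨p, r⟩ hp
  rw [HasAntidiagonal.mem_antidiagonal] at hp
  simp only at hp ⊢
  by_cases hpc : p ≤ c
  · obtain ⟨e, rfl⟩ : ∃ e, c = p + e := ⟨c - p, by omega⟩
    rw [add_assoc p e 1, GG_add, GG_add, GG_add, qPoch_succ]
    have t1 := qB_succ_right hq e d
    have t2 := qB_succ_left hq e d
    have e1 : e + d + 1 = a + r := by omega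
    rw [e1, pow_add] at t1 t2
    rw [← hp]
    have e2 : q ^ (p + (e + 1)) = q ^ p * q ^ (e + 1) := by rw [pow_add]
    rw [e2, pow_add q p e, pow_add q p r]
    linear_combination (qB q p r * v ^ r * phi q x v p * qPoch q (u * x) e) *
      (u * x * q ^ p * q ^ e * t1 + q ^ p * (1 - u * x * q ^ e) * t2)
  · rw [GG_lt q _ (c := c) _ (by omega), GG_lt q _ (c := c) _ (by omega)]
    by_cases hpc' : p = c + 1
    · subst hpc'; ring
    · rw [GG_lt _ _ _ (by omega)]; ring


theorem W_zero (q u v x : F) {a b c d : ℕ} (h : a + b ≠ c + d) :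
    Wfused q u v x a b c d = 0 := by
  rw [Wfused, if_neg h]

theorem W_E1 {q : F} (hq : ∀ j : ℕ, 1 ≤ j → qPoch q q j ≠ 0) (u v x : F) (hx : x ≠ 0)
    (a b c d : ℕ) (h : a + b = c + d + 1) :
    (1 - q ^ (d + 1)) * Wfused q u v x a b c (d + 1) =
      x * (1 - q ^ a) * Wfused q u v x (a - 1) b c d
        + v * q ^ a * (1 - q ^ b) * Wfused q u v x a (b - 1) c d := by
  have h0 := UU_E1 hq u v x a b c d h
  have hz : x ^ (((d + 1 : ℕ) : ℤ) - (b : ℤ)) = x * x ^ ((d : ℤ) - (b : ℤ)) := by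
    rw [← zpow_one_add₀ hx]; congr 1; push_cast; ring
  have hA : (1 - q ^ a) * Wfused q u v x (a - 1) b c d =
      (1 - q ^ a) * (x ^ ((d : ℤ) - (b : ℤ)) * UU q u v x b c d) := by
    cases a with
    | zero => simp
    | succ a => rw [Wfused_eq _ _ _ _ _ _ _ _ (by omega)]
  have hB : (1 - q ^ b) * Wfused q u v x a (b - 1) c d =
      (1 - q ^ b) * (x * x ^ ((d : ℤ) - (b : ℤ)) * UU q u v x (b - 1) c d) := by
    cases b with
    | zero => simp
    | succ b =>
      rw [Wfused_eq _ _ _ _ _ _ _ _ (by omega), ← zpow_one_add₀ hx]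
      congr 3; push_cast; ring
  rw [Wfused_eq _ _ _ _ _ _ _ _ (by omega), hz]
  linear_combination (x * x ^ ((d : ℤ) - (b : ℤ))) * h0 - x * hA - v * q ^ a * hB

theorem W_E2 {q : F} (hq : ∀ j : ℕ, 1 ≤ j → qPoch q q j ≠ 0) (u v x : F) (hx : x ≠ 0)
    (a b c d : ℕ) (h : a + b = c + d + 1) :
    (1 - q ^ (c + 1)) * Wfused q u v x a b (c + 1) d
      + u * q ^ c * ((1 - q ^ (d + 1)) * Wfused q u v x a b c (d + 1)) =
      q ^ b * (1 - q ^ a) * Wfused q u v x (a - 1) b c d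
        + (1 - q ^ b) * Wfused q u v x a (b - 1) c d := by
  have h0 := UU_E2 hq u v x a b c d h
  have hz : x ^ (((d + 1 : ℕ) : ℤ) - (b : ℤ)) = x * x ^ ((d : ℤ) - (b : ℤ)) := by
    rw [← zpow_one_add₀ hx]; congr 1; push_cast; ring
  have hA : (1 - q ^ a) * Wfused q u v x (a - 1) b c d =
      (1 - q ^ a) * (x ^ ((d : ℤ) - (b : ℤ)) * UU q u v x b c d) := by
    cases a with
    | zero => simp
    | succ a => rw [Wfused_eq _ _ _ _ _ _ _ _ (by omega)]
  have hB : (1 - q ^ b) * Wfused q u v x a (b - 1) c d =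
      (1 - q ^ b) * (x * x ^ ((d : ℤ) - (b : ℤ)) * UU q u v x (b - 1) c d) := by
    cases b with
    | zero => simp
    | succ b =>
      rw [Wfused_eq _ _ _ _ _ _ _ _ (by omega), ← zpow_one_add₀ hx]
      congr 3; push_cast; ring
  rw [Wfused_eq q u v x a b (c + 1) d (by omega), Wfused_eq q u v x a b c (d + 1) (by omega), hz]
  linear_combination (x ^ ((d : ℤ) - (b : ℤ))) * h0 - q ^ b * hA - hB

open Finset in
theorem R_eq_W {q : F} (hq : ∀ j : ℕ, 1 ≤ j → qPoch q q j ≠ 0) (z : F) (hz : z ≠ 0)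
    (a b c d : ℕ) : Rfused q z a b c d = Wfused q 1 0 z a b c d := by
  by_cases h : a + b = c + d
  · have hU : UU q 1 0 z b c d = z ^ b * GG q z c d b := by
      rw [UU, sum_eq_single (b, 0)]
      · simp [qB_zero_right hq, phi]
      · rintro ⟨p, r⟩ hp hne
        rw [HasAntidiagonal.mem_antidiagonal] at hp
        simp only at hp
        have : r ≠ 0 := by
          rintro rfl; apply hne; simp at hp; simp [hp]
        simp [this]
      · intro hn; simp at hn
    rw [Wfused_eq _ _ _ _ _ _ _ _ h, hU, Rfused, zpow_sub₀ hz, zpow_natCast, zpow_natCast]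
    by_cases hbc : b ≤ c
    · obtain ⟨e, rfl⟩ : ∃ e, c = b + e := ⟨c - b, by omega⟩
      have ha : a = e + d := by omega
      subst ha
      rw [if_pos ⟨h, hbc⟩, GG_add, Nat.add_sub_cancel_left, qBinom_add]
      field_simp
    · rw [if_neg (fun h => hbc h.2), GG_lt _ _ _ (by omega)]; simp
  · rw [W_zero _ _ _ _ h, Rfused, if_neg (fun h' => h h'.1)]

/-- the action of the weights on functions of two variables -/
def opW (q u v x : F) (g : ℕ → ℕ → F) (c d : ℕ) : F :=
  ∑ p ∈ Finset.HasAntidiagonal.antidiagonal (c + d), Wfused q u v x p.1 p.2 c d * g p.1 p.2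

theorem opW_add (q u v x : F) (g g' : ℕ → ℕ → F) (c d : ℕ) :
    opW q u v x (fun a b => g a b + g' a b) c d = opW q u v x g c d + opW q u v x g' c d := by
  simp [opW, mul_add, Finset.sum_add_distrib]

theorem opW_smul (q u v x t : F) (g : ℕ → ℕ → F) (c d : ℕ) :
    opW q u v x (fun a b => t * g a b) c d = t * opW q u v x g c d := by
  simp only [opW, Finset.mul_sum]
  exact Finset.sum_congr rfl fun _ _ => by ring

open Finset in
theorem opW_E_aux {q : F} (u v x : F) (g : ℕ → ℕ → F) (s t : ℕ → ℕ → F) (c d : ℕ) :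
    opW q u v x (fun a b => s a b * (1 - q ^ (a + 1)) * g (a + 1) b +
        t a b * (1 - q ^ (b + 1)) * g a (b + 1)) c d =
      ∑ p ∈ HasAntidiagonal.antidiagonal (c + d + 1),
        (s (p.1 - 1) p.2 * (1 - q ^ p.1) * Wfused q u v x (p.1 - 1) p.2 c d +
         t p.1 (p.2 - 1) * (1 - q ^ p.2) * Wfused q u v x p.1 (p.2 - 1) c d) * g p.1 p.2 := by
  simp only [add_mul, sum_add_distrib]
  rw [Nat.sum_antidiagonal_succ, Nat.sum_antidiagonal_succ']
  simp only [pow_zero, sub_self, mul_zero, zero_mul, zero_add, add_zero, Nat.add_sub_cancel, opW,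
    mul_add, sum_add_distrib]
  congr 1 <;> exact Finset.sum_congr rfl fun _ _ => by ring

open Finset in
theorem opW_E1 {q : F} (hq : ∀ j : ℕ, 1 ≤ j → qPoch q q j ≠ 0) (u v x : F) (hx : x ≠ 0)
    (g : ℕ → ℕ → F) (c d : ℕ) :
    (1 - q ^ (d + 1)) * opW q u v x g c (d + 1) =
    opW q u v x (fun a b => x * (1 - q ^ (a + 1)) * g (a + 1) b +
      (v * q ^ a) * (1 - q ^ (b + 1)) * g a (b + 1)) c d := by
  rw [opW_E_aux u v x g (fun _ _ => x) (fun a _ => v * q ^ a), opW, mul_sum, ← add_assoc]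
  apply sum_congr rfl
  rintro ⟨a, b⟩ h
  rw [HasAntidiagonal.mem_antidiagonal] at h
  simp only at h ⊢
  rw [← W_E1 hq u v x hx a b c d h]; ring

open Finset in
theorem opW_E2 {q : F} (hq : ∀ j : ℕ, 1 ≤ j → qPoch q q j ≠ 0) (u v x : F) (hx : x ≠ 0)
    (g : ℕ → ℕ → F) (c d : ℕ) :
    (1 - q ^ (c + 1)) * opW q u v x g (c + 1) d
      + u * q ^ c * ((1 - q ^ (d + 1)) * opW q u v x g c (d + 1)) =
    opW q u v x (fun a b => q ^ b * (1 - q ^ (a + 1)) * g (a + 1) b +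
      1 * (1 - q ^ (b + 1)) * g a (b + 1)) c d := by
  rw [opW_E_aux u v x g (fun _ b => q ^ b) (fun a _ => 1), opW, opW, mul_sum, mul_sum, mul_sum,
    ← add_assoc, show c + 1 + d = c + d + 1 by omega, ← sum_add_distrib]
  apply sum_congr rfl
  rintro ⟨a, b⟩ h
  rw [HasAntidiagonal.mem_antidiagonal] at h
  simp only at h ⊢
  rw [one_mul, ← W_E2 hq u v x hx a b c d h]; ring

open Finset in
theorem opW_K (q u v x : F) (g : ℕ → ℕ → F) (c d : ℕ) :
    opW q u v x (fun a b => q ^ a * (q ^ b * g a b)) c d = q ^ c * (q ^ d * opW q u v x g c d) := by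
  simp only [opW, mul_sum]
  apply sum_congr rfl
  rintro ⟨a, b⟩ h
  rw [HasAntidiagonal.mem_antidiagonal] at h
  simp only at h ⊢
  have : q ^ a * q ^ b = q ^ c * q ^ d := by rw [← pow_add, ← pow_add, h]
  linear_combination (Wfused q u v x a b c d * g a b) * this

/-- functions on the states of three lines -/
abbrev St (F : Type*) := ℕ → ℕ → ℕ → F

/-- lowering operators and diagonal operators -/
def oE1 (q : F) : Module.End F (St F) where
  toFun f := fun i j k => (1 - q ^ (i + 1)) * f (i + 1) j k
  map_add' f g := by funext i j k; simp [mul_add]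
  map_smul' t f := by funext i j k; simp; ring
def oE2 (q : F) : Module.End F (St F) where
  toFun f := fun i j k => (1 - q ^ (j + 1)) * f i (j + 1) k
  map_add' f g := by funext i j k; simp [mul_add]
  map_smul' t f := by funext i j k; simp; ring
def oE3 (q : F) : Module.End F (St F) where
  toFun f := fun i j k => (1 - q ^ (k + 1)) * f i j (k + 1)
  map_add' f g := by funext i j k; simp [mul_add]
  map_smul' t f := by funext i j k; simp; ring
def oK1 (q : F) : Module.End F (St F) where
  toFun f := fun i j k => q ^ i * f i j k
  map_add' f g := by funext i j k; simp [mul_add]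
  map_smul' t f := by funext i j k; simp; ring
def oK2 (q : F) : Module.End F (St F) where
  toFun f := fun i j k => q ^ j * f i j k
  map_add' f g := by funext i j k; simp [mul_add]
  map_smul' t f := by funext i j k; simp; ring
def oK3 (q : F) : Module.End F (St F) where
  toFun f := fun i j k => q ^ k * f i j k
  map_add' f g := by funext i j k; simp [mul_add]
  map_smul' t f := by funext i j k; simp; ring
def oT13 (q u v x : F) : Module.End F (St F) where
  toFun f := fun i j k => opW q u v x (fun a b => f b j a) k i
  map_add' f g := by funext i j k; exact opW_add ..
  map_smul' t f := by funext i j k; exact opW_smul ..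
def oT23 (q u v x : F) : Module.End F (St F) where
  toFun f := fun i j k => opW q u v x (fun a b => f i b a) k j
  map_add' f g := by funext i j k; exact opW_add ..
  map_smul' t f := by funext i j k; exact opW_smul ..
def oT12 (q u v x : F) : Module.End F (St F) where
  toFun f := fun i j k => opW q u v x (fun a b => f a b k) i j
  map_add' f g := by funext i j k; exact opW_add ..
  map_smul' t f := by funext i j k; exact opW_smul ..

theorem oT13_apply (q u v x : F) (f : St F) (i j k : ℕ) :
    oT13 q u v x f i j k = opW q u v x (fun a b => f b j a) k i := rfl
theorem oT23_apply (q u v x : F) (f : St F) (i j k : ℕ) :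
    oT23 q u v x f i j k = opW q u v x (fun a b => f i b a) k j := rfl
theorem oT12_apply (q u v x : F) (f : St F) (i j k : ℕ) :
    oT12 q u v x f i j k = opW q u v x (fun a b => f a b k) i j := rfl

section rels

theorem r13_E1 {q : F} (hq : ∀ j : ℕ, 1 ≤ j → qPoch q q j ≠ 0) (u v x : F) (hx : x ≠ 0) :
    oE1 q * oT13 q u v x = oT13 q u v x * (x • oE3 q + v • (oK3 q * oE1 q)) := by
  ext f i j k
  refine (opW_E1 hq u v x hx (fun a b => f b j a) k i).trans ?_
  rw [Module.End.mul_apply, oT13_apply]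
  congr 1; funext a b
  simp [oE1, oE3, oK3]; ring

theorem r13_E2 {q : F} (hq : ∀ j : ℕ, 1 ≤ j → qPoch q q j ≠ 0) (u v x : F) (hx : x ≠ 0) :
    (oE3 q + u • (oK3 q * oE1 q)) * oT13 q u v x
    = oT13 q u v x * (oK1 q * oE3 q + oE1 q) := by
  ext f i j k
  refine Eq.trans ?_ ((opW_E2 hq u v x hx (fun a b => f b j a) k i).trans ?_)
  · simp [oE1, oE3, oK3, oT13]; ring
  rw [Module.End.mul_apply, oT13_apply]
  congr 1; funext a b
  simp [oE1, oE3, oK1]; ring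

theorem r23_E1 {q : F} (hq : ∀ j : ℕ, 1 ≤ j → qPoch q q j ≠ 0) (u v x : F) (hx : x ≠ 0) :
    oE2 q * oT23 q u v x = oT23 q u v x * (x • oE3 q + v • (oK3 q * oE2 q)) := by
  ext f i j k
  refine (opW_E1 hq u v x hx (fun a b => f i b a) k j).trans ?_
  rw [Module.End.mul_apply, oT23_apply]
  congr 1; funext a b
  simp [oE2, oE3, oK3]; ring

theorem r23_E2 {q : F} (hq : ∀ j : ℕ, 1 ≤ j → qPoch q q j ≠ 0) (u v x : F) (hx : x ≠ 0) :
    (oE3 q + u • (oK3 q * oE2 q)) * oT23 q u v x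
    = oT23 q u v x * (oK2 q * oE3 q + oE2 q) := by
  ext f i j k
  refine Eq.trans ?_ ((opW_E2 hq u v x hx (fun a b => f i b a) k j).trans ?_)
  · simp [oE2, oE3, oK3, oT23]; ring
  rw [Module.End.mul_apply, oT23_apply]
  congr 1; funext a b
  simp [oE2, oE3, oK2]; ring

theorem r12_E1 {q : F} (hq : ∀ j : ℕ, 1 ≤ j → qPoch q q j ≠ 0) (u v x : F) (hx : x ≠ 0) :
    oE2 q * oT12 q u v x = oT12 q u v x * (x • oE1 q + v • (oK1 q * oE2 q)) := by
  ext f i j k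
  refine (opW_E1 hq u v x hx (fun a b => f a b k) i j).trans ?_
  rw [Module.End.mul_apply, oT12_apply]
  congr 1; funext a b
  simp [oE2, oE1, oK1]; ring

theorem r12_E2 {q : F} (hq : ∀ j : ℕ, 1 ≤ j → qPoch q q j ≠ 0) (u v x : F) (hx : x ≠ 0) :
    (oE1 q + u • (oK1 q * oE2 q)) * oT12 q u v x
    = oT12 q u v x * (oK2 q * oE1 q + oE2 q) := by
  ext f i j k
  refine Eq.trans ?_ ((opW_E2 hq u v x hx (fun a b => f a b k) i j).trans ?_)
  · simp [oE2, oE1, oK1, oT12]; ring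
  rw [Module.End.mul_apply, oT12_apply]
  congr 1; funext a b
  simp [oE2, oE1, oK2]; ring

end rels

section comms
variable (q u v x : F)

theorem c13_E2 : oE2 q * oT13 q u v x = oT13 q u v x * oE2 q := by
  ext f i j k; simp only [Module.End.mul_apply, oE2, oT13, LinearMap.coe_mk, AddHom.coe_mk, opW_smul]
theorem c13_K2 : oK2 q * oT13 q u v x = oT13 q u v x * oK2 q := by
  ext f i j k; simp only [Module.End.mul_apply, oK2, oT13, LinearMap.coe_mk, AddHom.coe_mk, opW_smul]
theorem c23_E1 : oE1 q * oT23 q u v x = oT23 q u v x * oE1 q := by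
  ext f i j k; simp only [Module.End.mul_apply, oE1, oT23, LinearMap.coe_mk, AddHom.coe_mk, opW_smul]
theorem c23_K1 : oK1 q * oT23 q u v x = oT23 q u v x * oK1 q := by
  ext f i j k; simp only [Module.End.mul_apply, oK1, oT23, LinearMap.coe_mk, AddHom.coe_mk, opW_smul]
theorem c12_E3 : oE3 q * oT12 q u v x = oT12 q u v x * oE3 q := by
  ext f i j k; simp only [Module.End.mul_apply, oE3, oT12, LinearMap.coe_mk, AddHom.coe_mk, opW_smul]
theorem c12_K3 : oK3 q * oT12 q u v x = oT12 q u v x * oK3 q := by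
  ext f i j k; simp only [Module.End.mul_apply, oK3, oT12, LinearMap.coe_mk, AddHom.coe_mk, opW_smul]
theorem c13_KK : oK3 q * oK1 q * oT13 q u v x = oT13 q u v x * (oK3 q * oK1 q) := by
  ext f i j k; simp only [Module.End.mul_apply, oK3, oK1, oT13, LinearMap.coe_mk, AddHom.coe_mk, opW_K]
theorem c23_KK : oK3 q * oK2 q * oT23 q u v x = oT23 q u v x * (oK3 q * oK2 q) := by
  ext f i j k; simp only [Module.End.mul_apply, oK3, oK2, oT23, LinearMap.coe_mk, AddHom.coe_mk, opW_K]
theorem c12_KK : oK1 q * oK2 q * oT12 q u v x = oT12 q u v x * (oK1 q * oK2 q) := by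
  ext f i j k; simp only [Module.End.mul_apply, oK1, oK2, oT12, LinearMap.coe_mk, AddHom.coe_mk, opW_K]

theorem cE1K2 : oE1 q * oK2 q = oK2 q * oE1 q := by
  ext f i j k; simp [oE1, oK2]; ring
theorem cE1K3 : oE1 q * oK3 q = oK3 q * oE1 q := by
  ext f i j k; simp [oE1, oK3]; ring
theorem cE2K1 : oE2 q * oK1 q = oK1 q * oE2 q := by
  ext f i j k; simp [oE2, oK1]; ring
theorem cE2K3 : oE2 q * oK3 q = oK3 q * oE2 q := by
  ext f i j k; simp [oE2, oK3]; ring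
theorem cE3K1 : oE3 q * oK1 q = oK1 q * oE3 q := by
  ext f i j k; simp [oE3, oK1]; ring
theorem cE3K2 : oE3 q * oK2 q = oK2 q * oE3 q := by
  ext f i j k; simp [oE3, oK2]; ring
theorem cK21 : oK2 q * oK1 q = oK1 q * oK2 q := by
  ext f i j k; simp [oK1, oK2]; ring
theorem cK31 : oK3 q * oK1 q = oK1 q * oK3 q := by
  ext f i j k; simp [oK1, oK3]; ring
theorem cK32 : oK3 q * oK2 q = oK2 q * oK3 q := by
  ext f i j k; simp [oK3, oK2]; ring
end comms


theorem ring_E1 {A : Type*} [Ring A] [Algebra F A] (v x y z : F) (hzy : z * y = x)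
    (T13 T23 T12 E1 E2 E3 K3 : A)
    (h13 : E1 * T13 = T13 * (y • E3 + v • (K3 * E1)))
    (h23 : E2 * T23 = T23 * (x • E3 + v • (K3 * E2)))
    (h12 : E2 * T12 = T12 * (z • E1))
    (c1 : E2 * T13 = T13 * E2) (c2 : E1 * T23 = T23 * E1)
    (c3 : E3 * T12 = T12 * E3) (c4 : K3 * T12 = T12 * K3) :
    E2 * (T13 * T23 * T12) = (T13 * T23 * T12) * (x • E3 + (v * z) • (K3 * E1)) ∧
    E2 * (T12 * T23 * T13) = (T12 * T23 * T13) * (x • E3 + (v * z) • (K3 * E1)) := by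
  constructor
  · calc E2 * (T13 * T23 * T12) = (E2 * T13) * T23 * T12 := by noncomm_ring
      _ = T13 * (E2 * T23) * T12 := by rw [c1]; noncomm_ring
      _ = T13 * T23 * (x • (E3 * T12) + v • (K3 * (E2 * T12))) := by
        rw [h23]; simp only [mul_add, add_mul, mul_assoc, smul_mul_assoc, mul_smul_comm]
      _ = T13 * T23 * (x • (T12 * E3) + v • ((K3 * T12) * z • E1)) := by
        rw [c3, h12]; simp only [mul_assoc]
      _ = _ := by
        rw [c4]; simp only [mul_add, mul_assoc, smul_mul_assoc, mul_smul_comm, smul_smul]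
  · calc E2 * (T12 * T23 * T13) = (E2 * T12) * T23 * T13 := by noncomm_ring
      _ = z • (T12 * (E1 * T23) * T13) := by
        rw [h12]; simp only [mul_assoc, smul_mul_assoc, mul_smul_comm]
      _ = z • (T12 * T23 * (E1 * T13)) := by rw [c2]; simp only [mul_assoc]
      _ = _ := by
        rw [h13]
        simp only [mul_add, smul_add, mul_assoc, mul_smul_comm, smul_smul, hzy, mul_comm v z]

theorem ring_E2 {A : Type*} [Ring A] [Algebra F A] (u : F)
    (T13 T23 T12 E1 E2 E3 K1 K2 K3 : A)
    (h13 : (E3 + u • (K3 * E1)) * T13 = T13 * (K1 * E3 + E1))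
    (h23 : (E3 + u • (K3 * E2)) * T23 = T23 * (K2 * E3 + E2))
    (h12 : (E1 + K1 * E2) * T12 = T12 * (K2 * E1 + E2))
    (c1 : E2 * T13 = T13 * E2) (c1' : K2 * T13 = T13 * K2)
    (c2 : E1 * T23 = T23 * E1) (c2' : K1 * T23 = T23 * K1)
    (c3 : E3 * T12 = T12 * E3) (c3' : K3 * T12 = T12 * K3)
    (k13 : K3 * K1 * T13 = T13 * (K3 * K1))
    (k23 : K3 * K2 * T23 = T23 * (K3 * K2))
    (k12 : K1 * K2 * T12 = T12 * (K1 * K2))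
    (m1 : K3 * K1 = K1 * K3) (m2 : K2 * K1 = K1 * K2) (m3 : K3 * K2 = K2 * K3) :
    (E3 + u • (K3 * E1) + u • (K3 * K1 * E2)) * (T13 * T23 * T12) =
      (T13 * T23 * T12) * (K2 * E1 + E2 + K1 * K2 * E3) ∧
    (E3 + u • (K3 * E1) + u • (K3 * K1 * E2)) * (T12 * T23 * T13) =
      (T12 * T23 * T13) * (K2 * E1 + E2 + K1 * K2 * E3) := by
  constructor
  · calc (E3 + u • (K3 * E1) + u • (K3 * K1 * E2)) * (T13 * T23 * T12)
        = ((E3 + u • (K3 * E1)) * T13 + u • (K3 * K1 * (E2 * T13))) * T23 * T12 := by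
          simp only [add_mul, mul_assoc, smul_mul_assoc]
      _ = (T13 * (K1 * E3 + E1) + u • ((K3 * K1 * T13) * E2)) * T23 * T12 := by
          rw [h13, c1]; simp only [mul_assoc]
      _ = T13 * (K1 * ((E3 + u • (K3 * E2)) * T23) + E1 * T23) * T12 := by
          rw [k13, m1]
          simp only [add_mul, mul_add, mul_assoc, smul_mul_assoc, mul_smul_comm]
          abel
      _ = T13 * ((K1 * T23) * (K2 * E3 + E2) + E1 * T23) * T12 := by
          rw [h23, mul_assoc K1]
      _ = T13 * T23 * (K1 * K2 * (E3 * T12) + (E1 + K1 * E2) * T12) := by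
          rw [c2', c2]
          simp only [add_mul, mul_add, mul_assoc]
          abel
      _ = T13 * T23 * ((K1 * K2 * T12) * E3 + T12 * (K2 * E1 + E2)) := by
          rw [c3, h12]; simp only [mul_assoc]
      _ = _ := by
          rw [k12]
          simp only [mul_add, mul_assoc]
          abel
  · calc (E3 + u • (K3 * E1) + u • (K3 * K1 * E2)) * (T12 * T23 * T13)
        = (E3 * T12 + u • (K3 * ((E1 + K1 * E2) * T12))) * T23 * T13 := by
          simp only [add_mul, mul_add, smul_add, mul_assoc, smul_mul_assoc]
          abel
      _ = (T12 * E3 + u • ((K3 * T12) * (K2 * E1 + E2))) * T23 * T13 := by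
          rw [h12, c3, mul_assoc K3]
      _ = T12 * ((E3 + u • (K3 * E2)) * T23 + u • (K3 * K2 * (E1 * T23))) * T13 := by
          rw [c3']
          simp only [add_mul, mul_add, smul_add, mul_assoc, smul_mul_assoc, mul_smul_comm]
          abel
      _ = T12 * (T23 * (K2 * E3 + E2) + u • ((K3 * K2 * T23) * E1)) * T13 := by
          rw [h23, c2]; simp only [mul_assoc]
      _ = T12 * T23 * (K2 * E3 + E2 + u • (K3 * (K2 * E1))) * T13 := by
          rw [k23]
          simp only [add_mul, mul_add, mul_assoc, smul_mul_assoc, mul_smul_comm]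
      _ = T12 * T23 * (K2 * E3 + E2 + u • (K2 * (K3 * E1))) * T13 := by
          rw [← mul_assoc K3, m3]; simp only [mul_assoc]
      _ = T12 * T23 * (K2 * ((E3 + u • (K3 * E1)) * T13) + E2 * T13) := by
          simp only [add_mul, mul_add, mul_assoc, smul_mul_assoc, mul_smul_comm]
          abel
      _ = T12 * T23 * ((K2 * T13) * (K1 * E3 + E1) + E2 * T13) := by
          rw [h13, mul_assoc K2]
      _ = T12 * T23 * (T13 * (K2 * K1 * E3 + K2 * E1) + T13 * E2) := by
          rw [c1', c1]; simp only [mul_add, mul_assoc]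
      _ = _ := by
          rw [m2]
          simp only [mul_add, mul_assoc]
          abel


section base
open Finset

theorem W_top0 {q : F} (hq : ∀ j : ℕ, 1 ≤ j → qPoch q q j ≠ 0) (u v x : F) (hx : x ≠ 0)
    (a b : ℕ) : Wfused q u v x a b 0 (a + b) = x ^ a * v ^ b := by
  rw [Wfused_eq _ _ _ _ _ _ _ _ (by omega), UU, sum_eq_single (0, b)]
  · have : (((a + b : ℕ) : ℤ) - (b : ℤ)) = (a : ℤ) := by push_cast; ring
    rw [this, zpow_natCast]
    simp [qB_zero_left hq, phi, GG, qPoch_zero]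
  · rintro ⟨p, r⟩ hp hne
    rw [HasAntidiagonal.mem_antidiagonal] at hp
    simp only at hp
    have : p ≠ 0 := by
      rintro rfl; apply hne; simp at hp; simp [hp]
    rw [GG_lt _ _ _ (by simp only; omega), mul_zero]
  · intro hn; simp at hn

theorem W_right0 {q : F} (hq : ∀ j : ℕ, 1 ≤ j → qPoch q q j ≠ 0) (u v x : F) (hx : x ≠ 0)
    (a b : ℕ) : x ^ b * Wfused q u v x a b (a + b) 0 =
      ∑ p ∈ HasAntidiagonal.antidiagonal b,
        qB q p.1 p.2 * v ^ p.2 * phi q x v p.1 * qPoch q (u * x) (a + p.2) := by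
  rw [Wfused_eq _ _ _ _ _ _ _ _ (by omega), ← mul_assoc, ← zpow_natCast, ← zpow_add₀ hx]
  have : ((b : ℤ) + (((0 : ℕ) : ℤ) - (b : ℤ))) = 0 := by push_cast; ring
  rw [this, zpow_zero, one_mul, UU]
  apply sum_congr rfl
  rintro ⟨p, r⟩ h
  rw [HasAntidiagonal.mem_antidiagonal] at h
  simp only at h ⊢
  rw [show a + b = p + (a + r) by omega, GG_add, qB_zero_right hq, mul_one]

theorem R_val (q z : F) (k m a2 : ℕ) :
    Rfused q z (k + m) a2 (a2 + k) m = z ^ m * qPoch q z k * qB q k m := by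
  rw [Rfused, if_pos ⟨by omega, by omega⟩, Nat.add_sub_cancel_left, qBinom_add]

theorem sum_assoc3 (n : ℕ) (X : ℕ → ℕ → ℕ → F) :
    ∑ s ∈ HasAntidiagonal.antidiagonal n, ∑ t ∈ HasAntidiagonal.antidiagonal s.2, X s.1 t.1 t.2 =
    ∑ s ∈ HasAntidiagonal.antidiagonal n, ∑ t ∈ HasAntidiagonal.antidiagonal s.1,
      X t.2 t.1 s.2 := by
  rw [sum_sigma', sum_sigma']
  refine sum_nbij' (fun w => ⟨(w.1.1 + w.2.1, w.2.2), (w.2.1, w.1.1)⟩)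
    (fun w => ⟨(w.2.2, w.2.1 + w.1.2), (w.2.1, w.1.2)⟩) ?_ ?_ ?_ ?_ ?_
  · rintro ⟨⟨a, b⟩, ⟨c, d⟩⟩ h; simp at h ⊢; omega
  · rintro ⟨⟨a, b⟩, ⟨c, d⟩⟩ h; simp at h ⊢; omega
  · rintro ⟨⟨a, b⟩, ⟨c, d⟩⟩ h; simp at h ⊢; omega
  · rintro ⟨⟨a, b⟩, ⟨c, d⟩⟩ h; simp at h ⊢; omega
  · rintro ⟨⟨a, b⟩, ⟨c, d⟩⟩ h; rfl

theorem qB_assoc {q : F} (hq : ∀ j : ℕ, 1 ≤ j → qPoch q q j ≠ 0) (k p r : ℕ) :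
    qB q k (p + r) * qB q p r = qB q (p + k) r * qB q p k := by
  have h1 := qPoch_ne hq k
  have h2 := qPoch_ne hq p
  have h3 := qPoch_ne hq r
  have h4 := qPoch_ne hq (p + r)
  have h5 := qPoch_ne hq (p + k)
  simp only [qB]
  rw [show k + (p + r) = p + k + r by omega]
  field_simp

/-- common value of both sides in the base case -/
def baseVal (q u v x y : F) (a1 a2 a3 : ℕ) : F :=
  v ^ a2 * y ^ a3 * ∑ s ∈ HasAntidiagonal.antidiagonal a1,
    qB q s.1 s.2 * phi q x (x / y * v) s.1 * v ^ s.2 * qPoch q (u * x) (a3 + s.2)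

def KL (q u v x y : F) (M a1 a2 a3 i j k : ℕ) : F :=
  ∑ c ∈ range M ×ˢ range M ×ˢ range M,
    Rfused q (x / y) a1 a2 c.1 c.2.1 * Wfused q u v x a3 c.2.1 c.2.2 j *
      Wfused q u v y c.2.2 c.1 k i

def KR (q u v x y : F) (M a1 a2 a3 i j k : ℕ) : F :=
  ∑ c ∈ range M ×ˢ range M ×ˢ range M,
    Wfused q u v y a3 a1 c.2.2 c.1 * Wfused q u v x c.2.2 a2 k c.2.1 *
      Rfused q (x / y) c.1 c.2.1 i j

theorem R_zero (q z : F) {a b c d : ℕ} (h : a + b ≠ c + d) : Rfused q z a b c d = 0 := by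
  rw [Rfused, if_neg (fun h' => h h'.1)]

theorem R_zero' (q z : F) {a b c d : ℕ} (h : c < b) : Rfused q z a b c d = 0 := by
  rw [Rfused, if_neg (fun h' => by omega)]

theorem KL_term_zero (q u v x y : F) {a1 a2 a3 i j k c1 c2 c3 : ℕ}
    (h : ¬ (a1 + a2 = c1 + c2 ∧ a2 ≤ c1 ∧ a3 + c2 = c3 + j ∧ c3 + c1 = k + i)) :
    Rfused q (x / y) a1 a2 c1 c2 * Wfused q u v x a3 c2 c3 j *
      Wfused q u v y c3 c1 k i = 0 := by
  by_cases h1 : a1 + a2 = c1 + c2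
  · by_cases h2 : a2 ≤ c1
    · by_cases h3 : a3 + c2 = c3 + j
      · rw [W_zero q u v y (a := c3) (by tauto), mul_zero]
      · rw [W_zero q u v x h3]; ring
    · rw [R_zero' _ _ (by omega)]; ring
  · rw [R_zero _ _ h1]; ring

theorem KR_term_zero (q u v x y : F) {a1 a2 a3 i j k c1 c2 c3 : ℕ}
    (h : ¬ (a3 + a1 = c3 + c1 ∧ c3 + a2 = k + c2 ∧ c1 + c2 = i + j)) :
    Wfused q u v y a3 a1 c3 c1 * Wfused q u v x c3 a2 k c2 *
      Rfused q (x / y) c1 c2 i j = 0 := by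
  by_cases h1 : a3 + a1 = c3 + c1
  · by_cases h2 : c3 + a2 = k + c2
    · rw [R_zero _ _ (by tauto), mul_zero]
    · rw [W_zero q u v x h2]; ring
  · rw [W_zero q u v y h1]; ring

theorem KL_base {q : F} (hq : ∀ j : ℕ, 1 ≤ j → qPoch q q j ≠ 0) (u v x y : F)
    (hx : x ≠ 0) (hy : y ≠ 0) (a1 a2 a3 M : ℕ) (hM : a1 + a2 + a3 < M) :
    KL q u v x y M a1 a2 a3 (a1 + a2 + a3) 0 0 = baseVal q u v x y a1 a2 a3 := by
  have h1 : KL q u v x y M a1 a2 a3 (a1 + a2 + a3) 0 0 =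
      ∑ s ∈ HasAntidiagonal.antidiagonal a1,
        Rfused q (x / y) a1 a2 (a2 + s.1) s.2 * Wfused q u v x a3 s.2 (a3 + s.2) 0 *
        Wfused q u v y (a3 + s.2) (a2 + s.1) 0 (a1 + a2 + a3) := by
    symm
    apply sum_of_injOn (fun s : ℕ × ℕ => (a2 + s.1, s.2, a3 + s.2))
    · rintro ⟨k, m⟩ _ ⟨k', m'⟩ _ h
      simp at h ⊢; omega
    · rintro ⟨k, m⟩ h
      simp at h ⊢; omega
    · rintro ⟨c1, c2, c3⟩ _ h
      apply KL_term_zero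
      rintro ⟨e1, e2, e3, e4⟩
      dsimp only at e1 e2 e3 e4
      apply h
      refine ⟨(c1 - a2, c2), ?_, ?_⟩
      · simp; omega
      · simp; omega
    · intro s _; rfl
  have h2 : ∀ s ∈ HasAntidiagonal.antidiagonal a1,
      Rfused q (x / y) a1 a2 (a2 + s.1) s.2 * Wfused q u v x a3 s.2 (a3 + s.2) 0 *
        Wfused q u v y (a3 + s.2) (a2 + s.1) 0 (a1 + a2 + a3) =
      v ^ a2 * y ^ a3 * ∑ t ∈ HasAntidiagonal.antidiagonal s.2,
        (fun k p r => qB q k (p + r) * qB q p r * (v ^ k * qPoch q (x / y) k) * phi q x v p * v ^ r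
          * qPoch q (u * x) (a3 + r)) s.1 t.1 t.2 := by
    rintro ⟨k, m⟩ h
    rw [HasAntidiagonal.mem_antidiagonal] at h
    simp only at h ⊢
    subst h
    rw [R_val, show k + m + a2 + a3 = (a3 + m) + (a2 + k) by omega, W_top0 hq u v y hy]
    have h3 := W_right0 hq u v x hx a3 m
    have h4 : ∑ t ∈ HasAntidiagonal.antidiagonal m,
        qB q k (t.1 + t.2) * qB q t.1 t.2 * (v ^ k * qPoch q (x / y) k) * phi q x v t.1 * v ^ t.2
          * qPoch q (u * x) (a3 + t.2) =
        qB q k m * (v ^ k * qPoch q (x / y) k) *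
          (x ^ m * Wfused q u v x a3 m (a3 + m) 0) := by
      rw [h3, mul_sum]
      apply sum_congr rfl
      rintro ⟨p, r⟩ h
      rw [HasAntidiagonal.mem_antidiagonal] at h
      simp only at h ⊢
      rw [h]; ring
    rw [h4, div_pow]
    field_simp
    ring
  rw [h1, sum_congr rfl h2, ← mul_sum]
  refine (congrArg _ (sum_assoc3 a1 (fun k p r => qB q k (p + r) * qB q p r *
    (v ^ k * qPoch q (x / y) k) * phi q x v p * v ^ r * qPoch q (u * x) (a3 + r)))).trans ?_
  rw [baseVal]
  congr 1
  apply sum_congr rfl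
  rintro ⟨n, r⟩ _
  simp only
  rw [← phi_vandermonde hq x v (x / y * v) n, mul_sum, sum_mul, sum_mul]
  apply sum_congr rfl
  rintro ⟨p, k⟩ h
  rw [HasAntidiagonal.mem_antidiagonal] at h
  simp only at h ⊢
  have e : phi q v (x / y * v) k = v ^ k * qPoch q (x / y) k := by
    rw [← phi_one, ← phi_smul, mul_one, mul_comm v]
  rw [e, qB_assoc hq, h]
  ring

theorem KR_base {q : F} (hq : ∀ j : ℕ, 1 ≤ j → qPoch q q j ≠ 0) (u v x y : F)
    (hx : x ≠ 0) (hy : y ≠ 0) (a1 a2 a3 M : ℕ) (hM : a1 + a2 + a3 < M) :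
    KR q u v x y M a1 a2 a3 (a1 + a2 + a3) 0 0 = baseVal q u v x y a1 a2 a3 := by
  have h1 : KR q u v x y M a1 a2 a3 (a1 + a2 + a3) 0 0 =
      ∑ s ∈ HasAntidiagonal.antidiagonal (a1 + a3),
        Wfused q u v y a3 a1 s.2 s.1 * Wfused q u v x s.2 a2 0 (s.2 + a2) *
        Rfused q (x / y) s.1 (s.2 + a2) (a1 + a2 + a3) 0 := by
    symm
    apply sum_of_injOn (fun s : ℕ × ℕ => (s.1, s.2 + a2, s.2))
    · rintro ⟨k, m⟩ _ ⟨k', m'⟩ _ h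
      simp at h ⊢; omega
    · rintro ⟨k, m⟩ h
      simp at h ⊢; omega
    · rintro ⟨c1, c2, c3⟩ _ h
      apply KR_term_zero
      rintro ⟨e1, e2, e3⟩
      dsimp only at e1 e2 e3
      apply h
      refine ⟨(c1, c3), ?_, ?_⟩
      · simp; omega
      · simp; omega
    · intro s _; rfl
  have h2 : ∀ s ∈ HasAntidiagonal.antidiagonal (a1 + a3),
      Wfused q u v y a3 a1 s.2 s.1 * Wfused q u v x s.2 a2 0 (s.2 + a2) *
        Rfused q (x / y) s.1 (s.2 + a2) (a1 + a2 + a3) 0 =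
      ∑ t ∈ HasAntidiagonal.antidiagonal a1,
        v ^ a2 * (y ^ a1)⁻¹ * (qB q t.1 t.2 * v ^ t.2 * phi q y v t.1) *
          (GG q (u * y) s.2 s.1 t.1 * y ^ s.1 * x ^ s.2 * qPoch q (x / y) s.1) := by
    rintro ⟨k, e⟩ h
    rw [HasAntidiagonal.mem_antidiagonal] at h
    simp only at h ⊢
    have hR := R_val q (x / y) k 0 (e + a2)
    rw [add_zero, show e + a2 + k = a1 + a2 + a3 by omega] at hR
    rw [hR, W_top0 hq u v x hx, Wfused_eq _ _ _ _ _ _ _ _ (by omega), UU, zpow_sub₀ hy,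
      zpow_natCast, zpow_natCast, qB_zero_right hq, mul_sum, sum_mul, sum_mul]
    apply sum_congr rfl
    intro t _
    field_simp
  rw [h1, sum_congr rfl h2, sum_comm, baseVal, mul_sum]
  apply sum_congr rfl
  rintro ⟨p, r⟩ h
  rw [HasAntidiagonal.mem_antidiagonal] at h
  simp only at h ⊢
  rw [← mul_sum]
  have h3 : ∑ s ∈ HasAntidiagonal.antidiagonal (a1 + a3),
      GG q (u * y) s.2 s.1 p * y ^ s.1 * x ^ s.2 * qPoch q (x / y) s.1 =
      ∑ s ∈ HasAntidiagonal.antidiagonal (a3 + r), x ^ p * y ^ (a3 + r) *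
        (qB q s.1 s.2 * phi q 1 (x / y) s.1 * phi q (x / y) (x / y * (u * y)) s.2) := by
    symm
    apply sum_of_injOn (fun s : ℕ × ℕ => (s.1, p + s.2))
    · rintro ⟨k, m⟩ _ ⟨k', m'⟩ _ h
      simp at h ⊢; omega
    · rintro ⟨k, m⟩ h
      simp at h ⊢; omega
    · rintro ⟨c1, c2⟩ h' h
      rw [HasAntidiagonal.mem_antidiagonal] at h'
      simp only at h'
      by_cases hp : p ≤ c2
      · exfalso
        apply h
        refine ⟨(c1, c2 - p), ?_, ?_⟩
        · simp; omega
        · simp; omega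
      · rw [GG_lt _ _ _ (by simp only; omega)]; ring
    · rintro ⟨k, e⟩ h
      rw [HasAntidiagonal.mem_antidiagonal] at h
      simp only at h ⊢
      have e1 : phi q (x / y) (x / y * (u * y)) e = (x / y) ^ e * qPoch q (u * y) e := by
        rw [← phi_one, ← phi_smul, mul_one]
      rw [e1, phi_one, GG_add, ← h, qB_comm q e k, div_pow]
      field_simp
      ring
  rw [h3, ← mul_sum, phi_vandermonde hq, phi_one]
  have e2 : phi q x (x / y * v) p = (x / y) ^ p * phi q y v p := by
    rw [← phi_smul]; congr 1; field_simp
  have e3 : x / y * (u * y) = u * x := by field_simp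
  rw [e2, e3, ← h, div_pow]
  field_simp
  ring

theorem K_base {q : F} (hq : ∀ j : ℕ, 1 ≤ j → qPoch q q j ≠ 0) (u v x y : F)
    (hx : x ≠ 0) (hy : y ≠ 0) (a1 a2 a3 n M : ℕ) (hM : n < M) :
    KL q u v x y M a1 a2 a3 n 0 0 = KR q u v x y M a1 a2 a3 n 0 0 := by
  by_cases h : a1 + a2 + a3 = n
  · subst h
    rw [KL_base hq u v x y hx hy _ _ _ _ hM, KR_base hq u v x y hx hy _ _ _ _ hM]
  · rw [KL, KR, sum_eq_zero, sum_eq_zero]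
    · rintro ⟨c1, c2, c3⟩ _
      apply KR_term_zero; omega
    · rintro ⟨c1, c2, c3⟩ _
      apply KL_term_zero; omega

end base

section final
open Finset

theorem opW_box (q u v x : F) (g : ℕ → ℕ → F) (c d M : ℕ) (h : c + d < M) :
    opW q u v x g c d = ∑ a ∈ range M, ∑ b ∈ range M, Wfused q u v x a b c d * g a b := by
  rw [opW, ← sum_product' (range M) (range M) (fun a b => Wfused q u v x a b c d * g a b)]
  apply sum_subset
  · rintro ⟨a, b⟩ hab
    rw [HasAntidiagonal.mem_antidiagonal] at hab
    simp only [mem_product, mem_range] at hab ⊢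
    omega
  · rintro ⟨a, b⟩ _ hab
    rw [HasAntidiagonal.mem_antidiagonal] at hab
    rw [W_zero _ _ _ _ hab, zero_mul]

theorem perm6L (s : Finset ℕ) (G : ℕ → ℕ → ℕ → ℕ → ℕ → ℕ → F) :
    ∑ c3 ∈ s, ∑ c1 ∈ s, ∑ a3 ∈ s, ∑ c2 ∈ s, ∑ a1 ∈ s, ∑ a2 ∈ s, G a1 a2 a3 c1 c2 c3 =
    ∑ a1 ∈ s, ∑ a2 ∈ s, ∑ a3 ∈ s, ∑ c1 ∈ s, ∑ c2 ∈ s, ∑ c3 ∈ s, G a1 a2 a3 c1 c2 c3 := by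
  simp only [sum_sigma']
  refine sum_nbij' (fun ⟨c3, c1, a3, c2, a1, a2⟩ => ⟨a1, a2, a3, c1, c2, c3⟩)
    (fun ⟨a1, a2, a3, c1, c2, c3⟩ => ⟨c3, c1, a3, c2, a1, a2⟩) ?_ ?_ ?_ ?_ ?_
  · rintro ⟨c3, c1, a3, c2, a1, a2⟩ h; simp at h ⊢; tauto
  · rintro ⟨c3, c1, a3, c2, a1, a2⟩ h; simp at h ⊢; tauto
  · rintro ⟨c3, c1, a3, c2, a1, a2⟩ h; rfl
  · rintro ⟨c3, c1, a3, c2, a1, a2⟩ h; rfl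
  · rintro ⟨c3, c1, a3, c2, a1, a2⟩ h; rfl

theorem perm6R (s : Finset ℕ) (G : ℕ → ℕ → ℕ → ℕ → ℕ → ℕ → F) :
    ∑ c1 ∈ s, ∑ c2 ∈ s, ∑ c3 ∈ s, ∑ a2 ∈ s, ∑ a3 ∈ s, ∑ a1 ∈ s, G a1 a2 a3 c1 c2 c3 =
    ∑ a1 ∈ s, ∑ a2 ∈ s, ∑ a3 ∈ s, ∑ c1 ∈ s, ∑ c2 ∈ s, ∑ c3 ∈ s, G a1 a2 a3 c1 c2 c3 := by
  simp only [sum_sigma']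
  refine sum_nbij' (fun ⟨c1, c2, c3, a2, a3, a1⟩ => ⟨a1, a2, a3, c1, c2, c3⟩)
    (fun ⟨a1, a2, a3, c1, c2, c3⟩ => ⟨c1, c2, c3, a2, a3, a1⟩) ?_ ?_ ?_ ?_ ?_
  · rintro ⟨c3, c1, a3, c2, a1, a2⟩ h; simp at h ⊢; tauto
  · rintro ⟨c3, c1, a3, c2, a1, a2⟩ h; simp at h ⊢; tauto
  · rintro ⟨c3, c1, a3, c2, a1, a2⟩ h; rfl
  · rintro ⟨c3, c1, a3, c2, a1, a2⟩ h; rfl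
  · rintro ⟨c3, c1, a3, c2, a1, a2⟩ h; rfl

/-- the two sides of the Yang-Baxter equation as operators -/
def opL (q u v x y : F) : Module.End F (St F) :=
  oT13 q u v y * oT23 q u v x * oT12 q 1 0 (x / y)
def opR (q u v x y : F) : Module.End F (St F) :=
  oT12 q 1 0 (x / y) * oT23 q u v x * oT13 q u v y

theorem opL_eq {q : F} (hq : ∀ j : ℕ, 1 ≤ j → qPoch q q j ≠ 0) (u v x y : F)
    (hx : x ≠ 0) (hy : y ≠ 0) (f : St F) (i j k M : ℕ) (hM : i + j + k < M) :
    opL q u v x y f i j k = ∑ a1 ∈ range M, ∑ a2 ∈ range M, ∑ a3 ∈ range M,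
      KL q u v x y M a1 a2 a3 i j k * f a1 a2 a3 := by
  have hz : x / y ≠ 0 := div_ne_zero hx hy
  simp only [KL, sum_product, sum_mul]
  rw [← perm6L]
  change opW q u v y (fun c3 c1 => opW q u v x (fun a3 c2 =>
    opW q 1 0 (x / y) (fun a1 a2 => f a1 a2 a3) c1 c2) c3 j) k i = _
  rw [opW_box _ _ _ _ _ _ _ M (by omega)]
  refine sum_congr rfl fun c3 _ => sum_congr rfl fun c1 _ => ?_
  by_cases h1 : c3 + c1 = k + i
  swap
  · simp [W_zero q u v y h1]
  rw [opW_box _ _ _ _ _ _ _ M (by omega), mul_sum]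
  refine sum_congr rfl fun a3 _ => ?_
  rw [mul_sum]
  refine sum_congr rfl fun c2 _ => ?_
  by_cases h2 : a3 + c2 = c3 + j
  swap
  · simp [W_zero q u v x h2]
  rw [opW_box _ _ _ _ _ _ _ M (by omega), mul_sum, mul_sum]
  refine sum_congr rfl fun a1 _ => ?_
  rw [mul_sum, mul_sum]
  refine sum_congr rfl fun a2 _ => ?_
  rw [R_eq_W hq _ hz]; ring

theorem opR_eq {q : F} (hq : ∀ j : ℕ, 1 ≤ j → qPoch q q j ≠ 0) (u v x y : F)
    (hx : x ≠ 0) (hy : y ≠ 0) (f : St F) (i j k M : ℕ) (hM : i + j + k < M) :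
    opR q u v x y f i j k = ∑ a1 ∈ range M, ∑ a2 ∈ range M, ∑ a3 ∈ range M,
      KR q u v x y M a1 a2 a3 i j k * f a1 a2 a3 := by
  have hz : x / y ≠ 0 := div_ne_zero hx hy
  simp only [KR, sum_product, sum_mul]
  rw [← perm6R]
  change opW q 1 0 (x / y) (fun c1 c2 => opW q u v x (fun c3 a2 =>
    opW q u v y (fun a3 a1 => f a1 a2 a3) c3 c1) k c2) i j = _
  rw [opW_box _ _ _ _ _ _ _ M (by omega)]
  refine sum_congr rfl fun c1 _ => sum_congr rfl fun c2 _ => ?_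
  by_cases h1 : c1 + c2 = i + j
  swap
  · simp [W_zero q _ _ _ h1, R_zero q _ h1]
  rw [opW_box _ _ _ _ _ _ _ M (by omega), mul_sum]
  refine sum_congr rfl fun c3 _ => ?_
  rw [mul_sum]
  refine sum_congr rfl fun a2 _ => ?_
  by_cases h2 : c3 + a2 = k + c2
  swap
  · simp [W_zero q u v x h2]
  rw [opW_box _ _ _ _ _ _ _ M (by omega), mul_sum, mul_sum]
  refine sum_congr rfl fun a3 _ => ?_
  rw [mul_sum, mul_sum]
  refine sum_congr rfl fun a1 _ => ?_
  rw [R_eq_W hq _ hz]; ring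

theorem op_E1 {q : F} (hq : ∀ j : ℕ, 1 ≤ j → qPoch q q j ≠ 0) (u v x y : F)
    (hx : x ≠ 0) (hy : y ≠ 0) (f : St F) : ∃ f' : St F, ∀ i j k,
    (1 - q ^ (j + 1)) * opL q u v x y f i (j + 1) k = opL q u v x y f' i j k ∧
    (1 - q ^ (j + 1)) * opR q u v x y f i (j + 1) k = opR q u v x y f' i j k := by
  have hz : x / y ≠ 0 := div_ne_zero hx hy
  have h := ring_E1 v x y (x / y) (by field_simp) (oT13 q u v y) (oT23 q u v x)
    (oT12 q 1 0 (x / y)) (oE1 q) (oE2 q) (oE3 q) (oK3 q)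
    (r13_E1 hq u v y hy) (r23_E1 hq u v x hx)
    (by simpa using r12_E1 hq 1 0 (x / y) hz) (c13_E2 ..) (c23_E1 ..) (c12_E3 ..) (c12_K3 ..)
  refine ⟨(x • oE3 q + (v * (x / y)) • (oK3 q * oE1 q)) f, fun i j k => ⟨?_, ?_⟩⟩
  · exact congrFun (congrFun (congrFun (LinearMap.congr_fun h.1 f) i) j) k
  · exact congrFun (congrFun (congrFun (LinearMap.congr_fun h.2 f) i) j) k

theorem op_E2 {q : F} (hq : ∀ j : ℕ, 1 ≤ j → qPoch q q j ≠ 0) (u v x y : F)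
    (hx : x ≠ 0) (hy : y ≠ 0) (f : St F) : ∃ f' : St F, ∀ i j k,
    (1 - q ^ (k + 1)) * opL q u v x y f i j (k + 1) +
      u * (q ^ k * ((1 - q ^ (i + 1)) * opL q u v x y f (i + 1) j k)) +
      u * (q ^ k * (q ^ i * ((1 - q ^ (j + 1)) * opL q u v x y f i (j + 1) k))) =
        opL q u v x y f' i j k ∧
    (1 - q ^ (k + 1)) * opR q u v x y f i j (k + 1) +
      u * (q ^ k * ((1 - q ^ (i + 1)) * opR q u v x y f (i + 1) j k)) +
      u * (q ^ k * (q ^ i * ((1 - q ^ (j + 1)) * opR q u v x y f i (j + 1) k))) =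
        opR q u v x y f' i j k := by
  have hz : x / y ≠ 0 := div_ne_zero hx hy
  have h := ring_E2 u (oT13 q u v y) (oT23 q u v x)
    (oT12 q 1 0 (x / y)) (oE1 q) (oE2 q) (oE3 q) (oK1 q) (oK2 q) (oK3 q)
    (r13_E2 hq u v y hy) (r23_E2 hq u v x hx)
    (by simpa using r12_E2 hq 1 0 (x / y) hz) (c13_E2 ..) (c13_K2 ..) (c23_E1 ..) (c23_K1 ..)
    (c12_E3 ..) (c12_K3 ..) (c13_KK ..) (c23_KK ..) (c12_KK ..) (cK31 q) (cK21 q) (cK32 q)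
  refine ⟨(oK2 q * oE1 q + oE2 q + oK1 q * oK2 q * oE3 q) f, fun i j k => ⟨?_, ?_⟩⟩
  · exact congrFun (congrFun (congrFun (LinearMap.congr_fun h.1 f) i) j) k
  · exact congrFun (congrFun (congrFun (LinearMap.congr_fun h.2 f) i) j) k

theorem opL_eq_opR {q : F} (hq : ∀ j : ℕ, 1 ≤ j → qPoch q q j ≠ 0) (u v x y : F)
    (hx : x ≠ 0) (hy : y ≠ 0) (N : ℕ) : ∀ (f : St F) (i j k : ℕ), i + j + k = N →
    opL q u v x y f i j k = opR q u v x y f i j k := by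
  induction N with
  | zero =>
    intro f i j k h
    obtain rfl : i = 0 := by omega
    obtain rfl : j = 0 := by omega
    obtain rfl : k = 0 := by omega
    rw [opL_eq hq u v x y hx hy f 0 0 0 1 (by omega), opR_eq hq u v x y hx hy f 0 0 0 1 (by omega)]
    simp only [K_base hq u v x y hx hy _ _ _ 0 1 (by omega)]
  | succ N ih =>
    have hj : ∀ (f : St F) (i j k : ℕ), i + (j + 1) + k = N + 1 →
        opL q u v x y f i (j + 1) k = opR q u v x y f i (j + 1) k := by
      intro f i j k h
      obtain ⟨f', hf⟩ := op_E1 hq u v x y hx hy f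
      apply mul_left_cancel₀ (one_sub_ne hq j)
      rw [(hf i j k).1, (hf i j k).2]
      exact ih _ _ _ _ (by omega)
    intro f i j k h
    cases j with
    | succ j => exact hj f i j k h
    | zero =>
      induction k generalizing i with
      | zero =>
        rw [opL_eq hq u v x y hx hy f i 0 0 (i + 1) (by omega),
          opR_eq hq u v x y hx hy f i 0 0 (i + 1) (by omega)]
        simp only [K_base hq u v x y hx hy _ _ _ i (i + 1) (by omega)]
      | succ k ihk =>
        obtain ⟨f', hf⟩ := op_E2 hq u v x y hx hy f
        apply mul_left_cancel₀ (one_sub_ne hq k)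
        have h1 := (hf i 0 k).1
        have h2 := (hf i 0 k).2
        rw [ih f' i 0 k (by omega), ihk (i + 1) (by omega), hj f i 0 k (by omega)] at h1
        linear_combination h1 - h2

theorem KL_eq_KR {q : F} (hq : ∀ j : ℕ, 1 ≤ j → qPoch q q j ≠ 0) (u v x y : F)
    (hx : x ≠ 0) (hy : y ≠ 0) (a1 a2 a3 i j k M : ℕ) (hM : i + j + k < M)
    (h1 : a1 < M) (h2 : a2 < M) (h3 : a3 < M) :
    KL q u v x y M a1 a2 a3 i j k = KR q u v x y M a1 a2 a3 i j k := by
  have h := opL_eq_opR hq u v x y hx hy _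
    (fun b1 b2 b3 => if b1 = a1 then if b2 = a2 then if b3 = a3 then 1 else 0 else 0 else 0) i j k
    rfl
  rw [opL_eq hq u v x y hx hy _ i j k M hM, opR_eq hq u v x y hx hy _ i j k M hM] at h
  simpa [h1, h2, h3] using h

end final

end helpers

/-- **Yang–Baxter equation for the fused weights `𝕎` with the fused R-matrix `ℝ`.** -/
theorem yang_baxter_fused {F : Type*} [Field F] (q u v x y : F)
    (hx : x ≠ 0) (hy : y ≠ 0)
    (hq : ∀ j : ℕ, 1 ≤ j → qPoch q q j ≠ 0)
    (a₁ a₂ a₃ b₁ b₂ b₃ : ℕ) :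
    (Function.support fun c : ℕ × ℕ × ℕ =>
        Rfused q (x / y) a₁ a₂ c.1 c.2.1 * Wfused q u v x a₃ c.2.1 c.2.2 b₂ *
          Wfused q u v y c.2.2 c.1 b₃ b₁).Finite ∧
    (Function.support fun c : ℕ × ℕ × ℕ =>
        Wfused q u v y a₃ a₁ c.2.2 c.1 * Wfused q u v x c.2.2 a₂ b₃ c.2.1 *
          Rfused q (x / y) c.1 c.2.1 b₁ b₂).Finite ∧
    (∑ᶠ c : ℕ × ℕ × ℕ,
        Rfused q (x / y) a₁ a₂ c.1 c.2.1 * Wfused q u v x a₃ c.2.1 c.2.2 b₂ *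
          Wfused q u v y c.2.2 c.1 b₃ b₁) =
      ∑ᶠ c : ℕ × ℕ × ℕ,
        Wfused q u v y a₃ a₁ c.2.2 c.1 * Wfused q u v x c.2.2 a₂ b₃ c.2.1 *
          Rfused q (x / y) c.1 c.2.1 b₁ b₂ := by
  have hL : (Function.support fun c : ℕ × ℕ × ℕ =>
        Rfused q (x / y) a₁ a₂ c.1 c.2.1 * Wfused q u v x a₃ c.2.1 c.2.2 b₂ *
          Wfused q u v y c.2.2 c.1 b₃ b₁) ⊆
      ((Finset.range (a₁ + a₂ + a₃ + b₁ + b₂ + b₃ + 1) ×ˢ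
        Finset.range (a₁ + a₂ + a₃ + b₁ + b₂ + b₃ + 1) ×ˢ
        Finset.range (a₁ + a₂ + a₃ + b₁ + b₂ + b₃ + 1) : Finset (ℕ × ℕ × ℕ)) :
          Set (ℕ × ℕ × ℕ)) := by
    rintro ⟨c1, c2, c3⟩ hc
    by_contra hn
    apply hc
    apply KL_term_zero
    rintro ⟨e1, e2, e3, e4⟩
    dsimp only at e1 e2 e3 e4
    apply hn
    simp only [Finset.coe_product, Finset.coe_range, Set.mem_prod, Set.mem_Iio]
    omega
  have hR : (Function.support fun c : ℕ × ℕ × ℕ =>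
        Wfused q u v y a₃ a₁ c.2.2 c.1 * Wfused q u v x c.2.2 a₂ b₃ c.2.1 *
          Rfused q (x / y) c.1 c.2.1 b₁ b₂) ⊆
      ((Finset.range (a₁ + a₂ + a₃ + b₁ + b₂ + b₃ + 1) ×ˢ
        Finset.range (a₁ + a₂ + a₃ + b₁ + b₂ + b₃ + 1) ×ˢ
        Finset.range (a₁ + a₂ + a₃ + b₁ + b₂ + b₃ + 1) : Finset (ℕ × ℕ × ℕ)) :
          Set (ℕ × ℕ × ℕ)) := by
    rintro ⟨c1, c2, c3⟩ hc
    by_contra hn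
    apply hc
    apply KR_term_zero
    rintro ⟨e1, e2, e3⟩
    dsimp only at e1 e2 e3
    apply hn
    simp only [Finset.coe_product, Finset.coe_range, Set.mem_prod, Set.mem_Iio]
    omega
  refine ⟨(Finset.finite_toSet _).subset hL, (Finset.finite_toSet _).subset hR, ?_⟩
  rw [finsum_eq_sum_of_support_subset _ hL, finsum_eq_sum_of_support_subset _ hR]
  exact KL_eq_KR hq u v x y hx hy a₁ a₂ a₃ b₁ b₂ b₃ _ (by omega) (by omega) (by omega) (by omega)
end
end
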